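/- For any k-bounded partition λ, the difference g^{(k)}_λ − s^{(k)}_λ lies in the ℤ-span of the k-Schur functions {s^{(k)}_μ : μ ∈ 𝒫^k, |μ| < |λ|}; equivalently, g^{(k)}_λ = s^{(k)}_λ + Σ_{μ ∈ 𝒫^k, |μ| < |λ|} d^{(k)}_{λμ} s^{(k)}_μ with integer coefficients d^{(k)}_{λμ}, so the top homogeneous component of g^{(k)}_λ is the k-Schur function s^{(k)}_λ. -/

import Mathlib

open scoped Classical

namespace AffineKTheory

noncomputable instance : Nonempty YoungDiagram := ⟨⊥⟩

noncomputable instance : Nonempty YoungDiagram := ⟨⊥⟩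

/-! ## Cells, hooks, cores, residues -/

/-- Hook length of the cell `(r, c)` in the diagram `γ`. -/
def hookLen (γ : YoungDiagram) (r c : ℕ) : ℕ :=
  (γ.rowLen r - c) + (γ.colLen c - r) - 1

/-- A `p`-core: a diagram none of whose cells has hook length `p`. -/
def IsCore (p : ℕ) (γ : YoungDiagram) : Prop :=
  ∀ c : ℕ × ℕ, c ∈ γ → hookLen γ c.1 c.2 ≠ p

/-- The `(k+1)`-residue of a cell.  (Rows of the Ferrers shape are indexed so that the cell
directly above `(r, c)` -- in the Ferrers sense of the next, shorter, row -- is `(r+1, c)`.) -/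
def residue (k : ℕ) (c : ℕ × ℕ) : ZMod (k + 1) :=
  (c.2 : ZMod (k + 1)) - (c.1 : ZMod (k + 1))

/-- A removable corner of `γ`: a cell of `γ` with no cell above it nor to its right. -/
def Removable (γ : YoungDiagram) (c : ℕ × ℕ) : Prop :=
  c ∈ γ ∧ (c.1 + 1, c.2) ∉ γ ∧ (c.1, c.2 + 1) ∉ γ

/-- An addable corner of `γ`: a cell outside `γ` whose addition again yields a partition shape. -/
def Addable (γ : YoungDiagram) (c : ℕ × ℕ) : Prop :=
  c ∉ γ ∧ ∀ d : ℕ × ℕ, d ≤ c → d ≠ c → d ∈ γ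

/-- A cell is `γ`-blocked if it lies below a cell of `γ`. -/
def Blocked (γ : YoungDiagram) (c : ℕ × ℕ) : Prop :=
  (c.1 + 1, c.2) ∈ γ

/-- The number of cells of `γ` in row `i` whose hook length is at most `k`:
the `i`-th part of `𝔭(γ)`. -/
noncomputable def pRow (k : ℕ) (γ : YoungDiagram) (i : ℕ) : ℕ :=
  (γ.cells.filter (fun c => c.1 = i ∧ hookLen γ c.1 c.2 ≤ k)).card

/-- The number of cells of `γ` with `k`-bounded hook length, i.e. `|𝔭(γ)|`. -/
noncomputable def pSize (k : ℕ) (γ : YoungDiagram) : ℕ :=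
  (γ.cells.filter (fun c => hookLen γ c.1 c.2 ≤ k)).card

/-- A `k`-bounded partition: all parts at most `k`. -/
def IsKBounded (k : ℕ) (lam : YoungDiagram) : Prop :=
  ∀ i, lam.rowLen i ≤ k

/-- `𝔭(γ)`: the `k`-bounded partition obtained from a `(k+1)`-core `γ` by deleting every cell of
hook length greater than `k` and reading off row lengths. -/
noncomputable def pPart (k : ℕ) (γ : YoungDiagram) : YoungDiagram :=
  Classical.epsilon fun lam => ∀ i, lam.rowLen i = pRow k γ i

/-- `𝔠(λ)`: the unique `(k+1)`-core corresponding to the `k`-bounded partition `λ` under the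
bijection `𝔭`. -/
noncomputable def coreOf (k : ℕ) (lam : YoungDiagram) : YoungDiagram :=
  Classical.epsilon fun γ => IsCore (k + 1) γ ∧ ∀ i, pRow k γ i = lam.rowLen i

/-- The `k`-conjugate `λ^{ω_k} = 𝔭(𝔠(λ)')` of a `k`-bounded partition. -/
noncomputable def kConj (k : ℕ) (lam : YoungDiagram) : YoungDiagram :=
  pPart k ((coreOf k lam).transpose)

/-- A `k`-bounded composition: a list of parts, each between `1` and `k`. -/
def IsKBoundedComp (k : ℕ) (α : List ℕ) : Prop :=
  ∀ a ∈ α, 1 ≤ a ∧ a ≤ k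

/-- Dominance order on partitions. -/
def Dominates (mu lam : YoungDiagram) : Prop :=
  mu.card = lam.card ∧
    ∀ n : ℕ, ∑ i ∈ Finset.range n, lam.rowLen i ≤ ∑ i ∈ Finset.range n, mu.rowLen i


/-! ## Set-valued fillings and affine set-valued tableaux -/

/-- A set-valued filling of the shape `γ`: each cell of `γ` carries a finite nonempty set of
positive integers, empty outside `γ`, with `max X < min Y` when `X` is directly below `Y` and
`max X ≤ min Y` when `X` is directly to the left of `Y`. -/
def IsSVFilling (γ : YoungDiagram) (e : ℕ × ℕ → Finset ℕ) : Prop :=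
  (∀ c : ℕ × ℕ, c ∈ γ ↔ (e c).Nonempty) ∧
  (∀ c : ℕ × ℕ, ∀ x ∈ e c, 0 < x) ∧
  (∀ r c : ℕ, ∀ x ∈ e (r, c), ∀ y ∈ e (r + 1, c), x < y) ∧
  (∀ r c : ℕ, ∀ x ∈ e (r, c), ∀ y ∈ e (r, c + 1), x ≤ y)

/-- The set of cells of `T_{≤ x}`: cells containing a letter `≤ x`. -/
noncomputable def shapeLe (γ : YoungDiagram) (e : ℕ × ℕ → Finset ℕ) (x : ℕ) : Finset (ℕ × ℕ) :=
  γ.cells.filter fun c => ∃ y ∈ e c, y ≤ x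

/-- A standard affine set-valued tableau of degree `n` and shape `γ`: a set-valued filling with
letters `1, …, n` such that for each `x`, the shape of `T_{≤x}` is a `(k+1)`-core and the letter
`x` occupies exactly all of its removable corners of one single residue. -/
def IsStdASVT (k n : ℕ) (γ : YoungDiagram) (e : ℕ × ℕ → Finset ℕ) : Prop :=
  IsSVFilling γ e ∧
  (∀ c : ℕ × ℕ, ∀ y ∈ e c, y ≤ n) ∧
  ∀ x : ℕ, 1 ≤ x → x ≤ n →
    ∃ δ : YoungDiagram, IsCore (k + 1) δ ∧ δ.cells = shapeLe γ e x ∧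
      ∃ i : ZMod (k + 1), (∃ c, x ∈ e c) ∧
        ∀ c : ℕ × ℕ, x ∈ e c ↔ Removable δ c ∧ residue k c = i

/-- The alphabet `𝒜_{α,x} = {Σ^{x-1}α + 1, …, Σ^x α}`. -/
def alphaBlock (α : List ℕ) (x : ℕ) : Finset ℕ :=
  Finset.Ioc ((α.take (x - 1)).sum) ((α.take x).sum)

/-- `c` is the lowest occurrence of the letter `y`. -/
def IsLowestOcc (e : ℕ × ℕ → Finset ℕ) (y : ℕ) (c : ℕ × ℕ) : Prop :=
  y ∈ e c ∧ ∀ d : ℕ × ℕ, y ∈ e d → c.1 ≤ d.1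

/-- `a` comes strictly before `b` in the reading order (top to bottom, left to right;
higher rows of the Ferrers shape have larger first coordinate here). -/
def ReadBefore (a b : ℕ × ℕ) : Prop :=
  b.1 < a.1 ∨ (a.1 = b.1 ∧ a.2 < b.2)

/-- An affine set-valued tableau of weight `α` and shape `γ`: a standard affine set-valued
tableau of degree `|α|` such that for each `x`, the lowest reading word in `𝒜_{α,x}` is
increasing, the letters of `𝒜_{α,x}` occupy exactly `α_x` distinct residues, and they form a
horizontal strip. -/
def IsASVT (k : ℕ) (α : List ℕ) (γ : YoungDiagram) (e : ℕ × ℕ → Finset ℕ) : Prop :=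
  IsStdASVT k α.sum γ e ∧
  ∀ x : ℕ, 1 ≤ x → x ≤ α.length →
    (∀ y z : ℕ, y ∈ alphaBlock α x → z ∈ alphaBlock α x → y < z →
      ∀ cy cz : ℕ × ℕ, IsLowestOcc e y cy → IsLowestOcc e z cz → ReadBefore cy cz) ∧
    (((γ.cells.filter fun c => ∃ y ∈ alphaBlock α x, y ∈ e c).image (residue k)).card
        = α.getD (x - 1) 0) ∧
    (∀ c d : ℕ × ℕ, (∃ y ∈ alphaBlock α x, y ∈ e c) → (∃ y ∈ alphaBlock α x, y ∈ e d) →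
      c.2 = d.2 → c = d)

/-- `𝒦^{(k)}_{λα}`: the number of affine set-valued tableaux of shape `𝔠(λ)` and weight `α`. -/
noncomputable def Kcal (k : ℕ) (lam : YoungDiagram) (α : List ℕ) : ℕ :=
  Nat.card {e : ℕ × ℕ → Finset ℕ // IsASVT k α (coreOf k lam) e}

/-- A `k`-tableau of shape `γ` and weight `α`: a semistandard filling with letters `1,…,ℓ(α)`
(recorded as `0` outside `γ`) in which the letter `i` occupies exactly `α_i` distinct residues. -/
def IsKTab (k : ℕ) (α : List ℕ) (γ : YoungDiagram) (u : ℕ × ℕ → ℕ) : Prop :=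
  (∀ c : ℕ × ℕ, c ∈ γ ↔ u c ≠ 0) ∧
  (∀ c : ℕ × ℕ, u c ≤ α.length) ∧
  (∀ r c : ℕ, (r, c) ∈ γ → (r + 1, c) ∈ γ → u (r, c) < u (r + 1, c)) ∧
  (∀ r c : ℕ, (r, c) ∈ γ → (r, c + 1) ∈ γ → u (r, c) ≤ u (r, c + 1)) ∧
  ∀ i : ℕ, 1 ≤ i → i ≤ α.length →
    ((γ.cells.filter fun c => u c = i).image (residue k)).card = α.getD (i - 1) 0

/-- `K^{(k)}_{λα}`: the number of `k`-tableaux of shape `𝔠(λ)` and weight `α`. -/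
noncomputable def Kktab (k : ℕ) (lam : YoungDiagram) (α : List ℕ) : ℕ :=
  Nat.card {u : ℕ × ℕ → ℕ // IsKTab k α (coreOf k lam) u}

/-- A plain set-valued tableau of shape `λ` and weight `α`. -/
def IsSVT (α : List ℕ) (lam : YoungDiagram) (e : ℕ × ℕ → Finset ℕ) : Prop :=
  IsSVFilling lam e ∧ (∀ c : ℕ × ℕ, ∀ x ∈ e c, x ≤ α.length) ∧
  ∀ i : ℕ, 1 ≤ i → i ≤ α.length →
    (lam.cells.filter fun c => i ∈ e c).card = α.getD (i - 1) 0

/-- `𝒦_{λα}`: the number of set-valued tableaux of shape `λ` and weight `α`. -/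
noncomputable def KcalSV (lam : YoungDiagram) (α : List ℕ) : ℕ :=
  Nat.card {e : ℕ × ℕ → Finset ℕ // IsSVT α lam e}


/-! ## The ring of symmetric functions, realized as `Λ ≅ ℤ[h₁, h₂, …]`,
the free polynomial ring on the complete homogeneous symmetric functions
(variable `n` is `h_{n+1}`). -/

abbrev SymFunc := MvPolynomial ℕ ℤ

/-- The complete homogeneous symmetric function `h_r` (`h_0 = 1`). -/
noncomputable def hSym : ℕ → SymFunc
  | 0 => 1
  | n + 1 => MvPolynomial.X n

/-- The elementary symmetric function
`e_n = Σ_{α ⊨ n} (-1)^{n - ℓ(α)} h_α` (sum over compositions of `n`). -/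
noncomputable def eSym (n : ℕ) : SymFunc :=
  ∑ c : Composition n, (-1 : SymFunc) ^ (n - c.length) * (c.blocks.map hSym).prod

/-- `h_λ = h_{λ_1} ⋯ h_{λ_ℓ}` for a partition `λ`. -/
noncomputable def hProd (lam : YoungDiagram) : SymFunc :=
  (lam.rowLens.map hSym).prod

/-- `Λ^{(k)} = ℤ[h_1, …, h_k]` as a subalgebra of `Λ`. -/
noncomputable def LambdaK (k : ℕ) : Subalgebra ℤ SymFunc :=
  MvPolynomial.supported ℤ {n : ℕ | n < k}

/-- The exponent vector of the monomial `h_λ` in the `h`-presentation of `Λ`. -/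
noncomputable def hExp (lam : YoungDiagram) : ℕ →₀ ℕ :=
  Multiset.toFinsupp ((lam.rowLens : Multiset ℕ).map fun r => r - 1)

/-- The coefficient of `h_λ` in the expansion of `p ∈ Λ` in the basis `{h_λ}`. -/
noncomputable def hCoeff (p : SymFunc) (lam : YoungDiagram) : ℤ :=
  MvPolynomial.coeff (hExp lam) p

/-- The Hall inner product `⟨p, F⟩` of `p ∈ Λ` with a (degree-wise finite) formal series
`F = Σ_ν F(ν) m_ν` in the monomial symmetric functions, characterized by
`⟨h_λ, m_μ⟩ = δ_{λμ}`. -/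
noncomputable def hallPair (p : SymFunc) (F : YoungDiagram → ℤ) : ℤ :=
  ∑ᶠ ν : YoungDiagram, hCoeff p ν * F ν

/-- The column dual Grothendieck polynomial `g_{1^m} = Σ_{j=1}^m binom(m-1, j-1) e_j`
(`g_{1^0} = 1`). -/
noncomputable def gColumn (m : ℕ) : SymFunc :=
  if m = 0 then 1 else ∑ j ∈ Finset.Icc 1 m, (((m - 1).choose (j - 1) : ℤ)) • eSym j

/-- The algebra endomorphism `Ω` of `Λ` with `Ω(h_ℓ) = Σ_{j=1}^ℓ binom(ℓ-1, j-1) e_j`. -/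
noncomputable def OmegaMap : SymFunc →ₐ[ℤ] SymFunc :=
  MvPolynomial.aeval fun n => gColumn (n + 1)

/-- Generalized binomial coefficient `C(n, j)` for an arbitrary integer `n`. -/
def genBinom (n : ℤ) (j : ℕ) : ℤ :=
  if 0 ≤ n then (n.toNat.choose j : ℤ) else (-1) ^ j * ((j + (-n - 1).toNat).choose j : ℤ)



/-! ## The defining systems for (k-K-)Schur-type bases -/

/-- `g` is the family of `k`-`K`-Schur functions: the unique elements of `Λ^{(k)}` with
`h_λ = Σ_{μ ∈ 𝒫^k, |μ| ≤ |λ|} (-1)^{|λ|+|μ|} 𝒦^{(k)}_{μλ} g^{(k)}_μ` for all `λ ∈ 𝒫^k`. -/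
def KKSchurSystem (k : ℕ) (g : YoungDiagram → SymFunc) : Prop :=
  (∀ lam : YoungDiagram, IsKBounded k lam → g lam ∈ LambdaK k) ∧
  ∀ lam : YoungDiagram, IsKBounded k lam →
    hProd lam = ∑ᶠ μ : YoungDiagram,
      if IsKBounded k μ ∧ μ.card ≤ lam.card then
        ((-1 : ℤ) ^ (lam.card + μ.card) * (Kcal k μ lam.rowLens : ℤ)) • g μ
      else 0

/-- `gd` is the family of dual Grothendieck polynomials: determined by
`h_μ = Σ_{|λ| ≤ |μ|} (-1)^{|λ|+|μ|} 𝒦_{λμ} g_λ` for all partitions `μ`. -/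
def DualGrothSystem (gd : YoungDiagram → SymFunc) : Prop :=
  ∀ mu : YoungDiagram,
    hProd mu = ∑ᶠ lam : YoungDiagram,
      if lam.card ≤ mu.card then
        ((-1 : ℤ) ^ (lam.card + mu.card) * (KcalSV lam mu.rowLens : ℤ)) • gd lam
      else 0

/-- `s` is the family of `k`-Schur functions: the unique elements of `Λ^{(k)}` with
`h_λ = s^{(k)}_λ + Σ_{μ ⊳ λ} K^{(k)}_{μλ} s^{(k)}_μ` for all `λ ∈ 𝒫^k`. -/
def KSchurSystem (k : ℕ) (s : YoungDiagram → SymFunc) : Prop :=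
  (∀ lam : YoungDiagram, IsKBounded k lam → s lam ∈ LambdaK k) ∧
  ∀ lam : YoungDiagram, IsKBounded k lam →
    hProd lam = s lam + ∑ᶠ μ : YoungDiagram,
      if IsKBounded k μ ∧ Dominates μ lam ∧ μ ≠ lam then
        (Kktab k μ lam.rowLens : ℤ) • s μ
      else 0


/-! ## Beads -/

/-- The position of the bead of row `r` in the Maya diagram of `γ`: the content of the last cell
of that row. -/
def beadPos (γ : YoungDiagram) (r : ℕ) : ℤ := (γ.rowLen r : ℤ) - r - 1

/-- The position `x` carries a bead of the Maya diagram of `γ`. -/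
def IsBead (γ : YoungDiagram) (x : ℤ) : Prop := ∃ r, beadPos γ r = x

/-- The bead-free position attached to the column `c`. -/
def gapPos (γ : YoungDiagram) (c : ℕ) : ℤ := (c : ℤ) - γ.colLen c

lemma beadPos_strictAnti (γ : YoungDiagram) : StrictAnti (beadPos γ) := by
  intro a b h
  have := γ.rowLen_anti a b h.le
  unfold beadPos
  omega

lemma gapPos_strictMono (γ : YoungDiagram) : StrictMono (gapPos γ) := by
  intro a b h
  have := γ.colLen_anti a b h.le
  unfold gapPos
  omega

lemma mem_iff_gapPos_lt_beadPos (γ : YoungDiagram) (r c : ℕ) :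
    (r, c) ∈ γ ↔ gapPos γ c < beadPos γ r := by
  have h1 : (r, c) ∈ γ ↔ c < γ.rowLen r := YoungDiagram.mem_iff_lt_rowLen
  have h2 : (r, c) ∈ γ ↔ r < γ.colLen c := YoungDiagram.mem_iff_lt_colLen
  unfold gapPos beadPos
  by_cases h : (r, c) ∈ γ
  · have := h1.1 h
    have := h2.1 h
    simp only [h, true_iff]
    omega
  · have := mt h1.2 h
    have := mt h2.2 h
    simp only [h, false_iff]
    omega

lemma not_isBead_gapPos (γ : YoungDiagram) (c : ℕ) : ¬ IsBead γ (gapPos γ c) := by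
  rintro ⟨r, hr⟩
  have h1 : (r, c) ∈ γ ↔ c < γ.rowLen r := YoungDiagram.mem_iff_lt_rowLen
  have h2 : (r, c) ∈ γ ↔ r < γ.colLen c := YoungDiagram.mem_iff_lt_colLen
  unfold gapPos beadPos at hr
  by_cases h : (r, c) ∈ γ
  · have := h1.1 h
    have := h2.1 h
    omega
  · have := mt h1.2 h
    have := mt h2.2 h
    omega

lemma exists_beadPos_lt (γ : YoungDiagram) (x : ℤ) : ∃ r, beadPos γ r < x := by
  refine ⟨γ.rowLen 0 + x.natAbs, ?_⟩
  have := γ.rowLen_anti 0 (γ.rowLen 0 + x.natAbs) (Nat.zero_le _)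
  unfold beadPos
  omega

lemma exists_gapPos_of_not_isBead {γ : YoungDiagram} {x : ℤ} (hx : ¬ IsBead γ x) :
    ∃ c, gapPos γ c = x := by
  have hex := exists_beadPos_lt γ x
  set r := Nat.find hex with hr
  have hlt : beadPos γ r < x := Nat.find_spec hex
  have hmin : ∀ r' < r, x < beadPos γ r' := fun r' h =>
    lt_of_le_of_ne (not_lt.1 (Nat.find_min hex h)) fun h' => hx ⟨r', h'.symm⟩
  obtain ⟨c, hc⟩ : ∃ c : ℕ, (c : ℤ) = x + r := by
    refine ⟨(x + r).toNat, ?_⟩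
    unfold beadPos at hlt
    omega
  have hcol : γ.colLen c = r := by
    apply le_antisymm
    · by_contra hcon
      have hmem : (r, c) ∈ γ := YoungDiagram.mem_iff_lt_colLen.2 (not_le.1 hcon)
      have := YoungDiagram.mem_iff_lt_rowLen.1 hmem
      unfold beadPos at hlt
      omega
    · rcases Nat.eq_zero_or_pos r with h0 | hpos
      · omega
      have h1 := hmin (r - 1) (by omega)
      have hmem : (r - 1, c) ∈ γ := by
        apply YoungDiagram.mem_iff_lt_rowLen.2
        unfold beadPos at h1
        omega
      have := YoungDiagram.mem_iff_lt_colLen.1 hmem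
      omega
  exact ⟨c, by unfold gapPos; omega⟩

lemma hookLen_eq {γ : YoungDiagram} {r c : ℕ} (h : (r, c) ∈ γ) :
    (hookLen γ r c : ℤ) = beadPos γ r - gapPos γ c := by
  have := YoungDiagram.mem_iff_lt_rowLen.1 h
  have := YoungDiagram.mem_iff_lt_colLen.1 h
  unfold hookLen beadPos gapPos
  omega

/-- A diagram is a `p`-core iff its set of beads is stable under translation by `-p`. -/
lemma isCore_iff {p : ℕ} (hp : 0 < p) (γ : YoungDiagram) :
    IsCore p γ ↔ ∀ x, IsBead γ x → IsBead γ (x - p) := by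
  constructor
  · rintro h _ ⟨r, rfl⟩
    by_contra hx
    obtain ⟨c, hc⟩ := exists_gapPos_of_not_isBead hx
    have hmem : (r, c) ∈ γ := by
      rw [mem_iff_gapPos_lt_beadPos]
      omega
    have h1 := h (r, c) hmem
    have h2 := hookLen_eq hmem
    apply h1
    simp only
    omega
  · rintro h ⟨r, c⟩ hmem hh
    have h2 := hookLen_eq hmem
    simp only at hh
    apply not_isBead_gapPos γ c
    have := h _ ⟨r, rfl⟩
    rwa [show beadPos γ r - p = gapPos γ c by omega] at this

lemma IsCore.isBead_of_le {k : ℕ} {γ : YoungDiagram} (h : IsCore (k + 1) γ) {x y : ℤ}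
    (hx : IsBead γ x) (hyx : y ≤ x) (hres : (y : ZMod (k + 1)) = (x : ZMod (k + 1))) :
    IsBead γ y := by
  rw [isCore_iff (Nat.succ_pos k)] at h
  obtain ⟨m, hm⟩ := (ZMod.intCast_eq_intCast_iff_dvd_sub y x (k + 1)).1 hres
  have hm0 : 0 ≤ m := by
    by_contra hneg
    have : ((k + 1 : ℕ) : ℤ) * m < 0 := mul_neg_of_pos_of_neg (by positivity) (by omega)
    omega
  have key : ∀ n : ℕ, IsBead γ (x - ((k + 1 : ℕ) : ℤ) * n) := by
    intro n
    induction n with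
    | zero => simpa using hx
    | succ n ih =>
      have := h _ ih
      convert this using 1
      push_cast
      ring
  have := key m.toNat
  rwa [show x - ((k + 1 : ℕ) : ℤ) * (m.toNat : ℤ) = y by rw [Int.toNat_of_nonneg hm0]; omega]
    at this

/-- The number of bead-free positions among `x - k, …, x`. -/
noncomputable def gapCount (k : ℕ) (γ : YoungDiagram) (x : ℤ) : ℕ :=
  ((Finset.Icc (x - k) x).filter fun t => ¬ IsBead γ t).card

lemma pRow_eq_gapCount (k : ℕ) (γ : YoungDiagram) (r : ℕ) :
    pRow k γ r = gapCount k γ (beadPos γ r) := by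
  unfold pRow gapCount
  refine Finset.card_bij (fun c _ => gapPos γ c.2) ?_ ?_ ?_
  · rintro ⟨a, c⟩ h
    simp only [Finset.mem_filter, YoungDiagram.mem_cells] at h
    obtain ⟨hm, rfl, hh⟩ := h
    have h1 := hookLen_eq hm
    have h2 := (mem_iff_gapPos_lt_beadPos γ a c).1 hm
    simp only [Finset.mem_filter, Finset.mem_Icc]
    exact ⟨by omega, not_isBead_gapPos γ c⟩
  · rintro ⟨a, c⟩ h ⟨a', c'⟩ h' heq
    simp only [Finset.mem_filter] at h h'
    have := (gapPos_strictMono γ).injective heq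
    simp only at this
    rw [Prod.mk.injEq]
    exact ⟨h.2.1.trans h'.2.1.symm, this⟩
  · intro t ht
    simp only [Finset.mem_filter, Finset.mem_Icc] at ht
    obtain ⟨c, hc⟩ := exists_gapPos_of_not_isBead ht.2
    have hne : t ≠ beadPos γ r := fun h => ht.2 ⟨r, h.symm⟩
    have hmem : (r, c) ∈ γ := by
      rw [mem_iff_gapPos_lt_beadPos]
      omega
    have h1 := hookLen_eq hmem
    refine ⟨(r, c), ?_, hc⟩
    simp only [Finset.mem_filter, YoungDiagram.mem_cells]
    exact ⟨hmem, trivial, by omega⟩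

lemma gapCount_succ (k : ℕ) (γ : YoungDiagram) (x : ℤ) :
    gapCount k γ (x + 1) + (if IsBead γ (x - k) then 0 else 1) =
      gapCount k γ x + (if IsBead γ (x + 1) then 0 else 1) := by
  have e1 : Finset.Icc (x - k) (x + 1) = insert (x - k) (Finset.Icc (x + 1 - k) (x + 1)) := by
    ext t
    simp only [Finset.mem_Icc, Finset.mem_insert]
    omega
  have e2 : Finset.Icc (x - k) (x + 1) = insert (x + 1) (Finset.Icc (x - k) x) := by
    ext t
    simp only [Finset.mem_Icc, Finset.mem_insert]
    omega
  have c1 : ((Finset.Icc (x - k) (x + 1)).filter fun t => ¬ IsBead γ t).card =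
      gapCount k γ (x + 1) + (if IsBead γ (x - k) then 0 else 1) := by
    rw [e1, Finset.filter_insert]
    unfold gapCount
    split_ifs with h1
    · simp
    · rw [Finset.card_insert_of_notMem]
      simp
  have c2 : ((Finset.Icc (x - k) (x + 1)).filter fun t => ¬ IsBead γ t).card =
      gapCount k γ x + (if IsBead γ (x + 1) then 0 else 1) := by
    rw [e2, Finset.filter_insert]
    unfold gapCount
    split_ifs with h1
    · simp
    · rw [Finset.card_insert_of_notMem]
      simp
  rw [← c1, c2]

/-! ## Corners in terms of beads -/

lemma isBead_sub_one_iff (γ : YoungDiagram) (r : ℕ) :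
    IsBead γ (beadPos γ r - 1) ↔ γ.rowLen (r + 1) = γ.rowLen r := by
  constructor
  · rintro ⟨r', h⟩
    have h1 : r < r' := (beadPos_strictAnti γ).lt_iff_gt.1 (by omega)
    have h2 := γ.rowLen_anti r (r + 1) (by omega)
    have h3 := γ.rowLen_anti (r + 1) r' (by omega)
    unfold beadPos at h
    omega
  · intro h
    refine ⟨r + 1, ?_⟩
    unfold beadPos
    omega

lemma isBead_add_one_iff (γ : YoungDiagram) (r : ℕ) :
    IsBead γ (beadPos γ r + 1) ↔ ∃ r', r = r' + 1 ∧ γ.rowLen r' = γ.rowLen r := by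
  constructor
  · rintro ⟨r', h⟩
    have h1 : r' < r := (beadPos_strictAnti γ).lt_iff_gt.1 (by omega)
    have h2 := γ.rowLen_anti r' (r - 1) (by omega)
    have h3 := γ.rowLen_anti (r - 1) r (by omega)
    unfold beadPos at h
    refine ⟨r - 1, by omega, by omega⟩
  · rintro ⟨r', rfl, h⟩
    refine ⟨r', ?_⟩
    unfold beadPos
    push_cast
    omega

lemma removable_iff (γ : YoungDiagram) (r c : ℕ) :
    Removable γ (r, c) ↔ c + 1 = γ.rowLen r ∧ ¬ IsBead γ (beadPos γ r - 1) := by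
  have := γ.rowLen_anti r (r + 1) (by omega)
  simp only [Removable, YoungDiagram.mem_iff_lt_rowLen, isBead_sub_one_iff]
  omega

lemma addable_iff (γ : YoungDiagram) (r c : ℕ) :
    Addable γ (r, c) ↔ c = γ.rowLen r ∧ ¬ IsBead γ (beadPos γ r + 1) := by
  rw [isBead_add_one_iff]
  constructor
  · rintro ⟨h1, h2⟩
    rw [YoungDiagram.mem_iff_lt_rowLen] at h1
    have hc : c = γ.rowLen r := by
      by_contra hne
      have := h2 (r, γ.rowLen r) (Prod.mk_le_mk.2 ⟨le_rfl, by omega⟩)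
        (by rw [Ne, Prod.mk.injEq]; omega)
      rw [YoungDiagram.mem_iff_lt_rowLen] at this
      omega
    refine ⟨hc, ?_⟩
    rintro ⟨r', rfl, h⟩
    have := h2 (r', c) (Prod.mk_le_mk.2 ⟨by omega, le_rfl⟩) (by rw [Ne, Prod.mk.injEq]; omega)
    rw [YoungDiagram.mem_iff_lt_rowLen] at this
    omega
  · rintro ⟨rfl, h⟩
    refine ⟨by rw [YoungDiagram.mem_iff_lt_rowLen]; omega, ?_⟩
    rintro ⟨a, b⟩ hle hne
    obtain ⟨ha, hb⟩ := Prod.mk_le_mk.1 hle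
    rw [Ne, Prod.mk.injEq] at hne
    rw [YoungDiagram.mem_iff_lt_rowLen]
    rcases Nat.lt_or_ge a r with hlt | hge
    · have h1 := γ.rowLen_anti a (r - 1) (by omega)
      have h2 := γ.rowLen_anti (r - 1) r (by omega)
      have h3 : γ.rowLen (r - 1) ≠ γ.rowLen r := fun h' => h ⟨r - 1, by omega, h'⟩
      omega
    · have : a = r := by omega
      subst this
      omega

lemma residue_eq_of_add_one (k : ℕ) (γ : YoungDiagram) {r c : ℕ} (h : c + 1 = γ.rowLen r) :
    residue k (r, c) = (beadPos γ r : ZMod (k + 1)) := by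
  unfold residue beadPos
  rw [← h]
  push_cast
  ring

lemma residue_rowLen (k : ℕ) (γ : YoungDiagram) (r : ℕ) :
    residue k (r, γ.rowLen r) = ((beadPos γ r + 1 : ℤ) : ZMod (k + 1)) := by
  unfold residue beadPos
  push_cast
  ring

/-! ## The action of a simple reflection on diagrams -/

/-- The Young diagram with prescribed antitone row lengths. -/
def ofRowFun (f : ℕ → ℕ) (hf : Antitone f) (N : ℕ) : YoungDiagram where
  cells := (Finset.range N ×ˢ Finset.range (f 0)).filter fun c => c.2 < f c.1
  isLowerSet := by
    rintro ⟨a, b⟩ ⟨a', b'⟩ hle h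
    obtain ⟨h1, h2⟩ := Prod.mk_le_mk.1 hle
    simp only [Finset.coe_filter, Finset.mem_product, Finset.mem_range, Set.mem_ofPred_eq] at h ⊢
    have := hf h1
    omega

lemma rowLen_ofRowFun {f : ℕ → ℕ} (hf : Antitone f) {N : ℕ} (hN : f N = 0) (r : ℕ) :
    (ofRowFun f hf N).rowLen r = f r := by
  have key : ∀ c, c < (ofRowFun f hf N).rowLen r ↔ c < f r := by
    intro c
    rw [← YoungDiagram.mem_iff_lt_rowLen, ← YoungDiagram.mem_cells]
    simp only [ofRowFun, Finset.mem_filter, Finset.mem_product, Finset.mem_range]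
    refine ⟨fun h => h.2, fun h => ⟨⟨?_, ?_⟩, h⟩⟩
    · by_contra hr
      have := hf (not_lt.1 hr)
      omega
    · have := hf (Nat.zero_le r)
      omega
  have h1 := key (f r)
  have h2 := key ((ofRowFun f hf N).rowLen r)
  omega

/-- Row lengths after exchanging all removable and addable corners of residue `i`. -/
noncomputable def actRow (k : ℕ) (γ : YoungDiagram) (i : ZMod (k + 1)) (r : ℕ) : ℕ :=
  if (beadPos γ r : ZMod (k + 1)) = i ∧ ¬ IsBead γ (beadPos γ r - 1) then γ.rowLen r - 1
  else if ((beadPos γ r + 1 : ℤ) : ZMod (k + 1)) = i ∧ ¬ IsBead γ (beadPos γ r + 1) then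
    γ.rowLen r + 1
  else γ.rowLen r

lemma rowLen_pos_of_not_isBead {γ : YoungDiagram} {r : ℕ} (h : ¬ IsBead γ (beadPos γ r - 1)) :
    0 < γ.rowLen r := by
  rw [isBead_sub_one_iff] at h
  have := γ.rowLen_anti r (r + 1) (by omega)
  omega

lemma ZMod.one_ne_zero_of_pos {k : ℕ} (hk : 1 ≤ k) : (1 : ZMod (k + 1)) ≠ 0 := by
  have : Fact (1 < k + 1) := ⟨by omega⟩
  exact one_ne_zero

lemma intCast_sub_one_ne {k : ℕ} (hk : 1 ≤ k) {x : ℤ} {i : ZMod (k + 1)} (h : (x : ZMod (k + 1)) = i) :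
    ((x + 1 : ℤ) : ZMod (k + 1)) ≠ i := by
  intro h'
  push_cast at h'
  rw [h] at h'
  exact ZMod.one_ne_zero_of_pos hk (by simpa using h')

lemma actRow_antitone {k : ℕ} (hk : 1 ≤ k) (γ : YoungDiagram) (i : ZMod (k + 1)) :
    Antitone (actRow k γ i) := by
  apply antitone_nat_of_succ_le
  intro r
  have h0 := γ.rowLen_anti r (r + 1) (by omega)
  have hb : beadPos γ r = γ.rowLen r - r - 1 := rfl
  have hb' : beadPos γ (r + 1) = γ.rowLen (r + 1) - r - 2 := by
    unfold beadPos
    push_cast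
    ring
  have h1 := isBead_sub_one_iff γ r
  have h2 := isBead_add_one_iff γ (r + 1)
  have hlow : (beadPos γ r : ZMod (k + 1)) = i ∧ ¬ IsBead γ (beadPos γ r - 1) →
      γ.rowLen (r + 1) < γ.rowLen r := fun h =>
    lt_of_le_of_ne h0 fun h' => h.2 (h1.2 h')
  have hupp : ((beadPos γ (r + 1) + 1 : ℤ) : ZMod (k + 1)) = i ∧
      ¬ IsBead γ (beadPos γ (r + 1) + 1) → γ.rowLen (r + 1) < γ.rowLen r := fun h =>
    lt_of_le_of_ne h0 fun h' => h.2 (h2.2 ⟨r, rfl, h'.symm⟩)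
  have hboth : (beadPos γ r : ZMod (k + 1)) = i →
      ((beadPos γ (r + 1) + 1 : ℤ) : ZMod (k + 1)) = i → γ.rowLen (r + 1) + 1 ≠ γ.rowLen r := by
    intro h h' heq
    rw [show beadPos γ r = (beadPos γ (r + 1) + 1) + 1 by omega] at h
    exact intCast_sub_one_ne hk h' h
  unfold actRow
  split_ifs with a1 a2 a3 a4 a5 a6 a7 a8 <;> first
    | omega
    | (have := hlow (by assumption); omega)
    | (have := hupp (by assumption); omega)
    | (have := hlow (by assumption); have := hboth (And.left (by assumption)) (And.left (by assumption)); omega)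

/-- Exchange all removable and all addable corners of residue `i`. -/
noncomputable def act {k : ℕ} (hk : 1 ≤ k) (γ : YoungDiagram) (i : ZMod (k + 1)) : YoungDiagram :=
  ofRowFun (actRow k γ i) (actRow_antitone hk γ i) (γ.colLen 0 + 1)

lemma rowLen_eq_zero_iff (γ : YoungDiagram) (r : ℕ) : γ.rowLen r = 0 ↔ γ.colLen 0 ≤ r := by
  have h1 : (r, 0) ∈ γ ↔ 0 < γ.rowLen r := YoungDiagram.mem_iff_lt_rowLen
  have h2 : (r, 0) ∈ γ ↔ r < γ.colLen 0 := YoungDiagram.mem_iff_lt_colLen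
  rw [h1] at h2
  omega

lemma rowLen_act {k : ℕ} (hk : 1 ≤ k) (γ : YoungDiagram) (i : ZMod (k + 1)) (r : ℕ) :
    (act hk γ i).rowLen r = actRow k γ i r := by
  apply rowLen_ofRowFun
  have h0 := (rowLen_eq_zero_iff γ (γ.colLen 0 + 1)).2 (by omega)
  have h1 := (rowLen_eq_zero_iff γ (γ.colLen 0)).2 le_rfl
  unfold actRow
  split_ifs with a b
  · omega
  · exact absurd ((isBead_add_one_iff γ _).2 ⟨_, rfl, h1.trans h0.symm⟩) b.2
  · exact h0

lemma beadPos_act {k : ℕ} (hk : 1 ≤ k) (γ : YoungDiagram) (i : ZMod (k + 1)) (r : ℕ) :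
    beadPos (act hk γ i) r =
      if (beadPos γ r : ZMod (k + 1)) = i ∧ ¬ IsBead γ (beadPos γ r - 1) then beadPos γ r - 1
      else if ((beadPos γ r + 1 : ℤ) : ZMod (k + 1)) = i ∧ ¬ IsBead γ (beadPos γ r + 1) then
        beadPos γ r + 1
      else beadPos γ r := by
  have h : beadPos (act hk γ i) r = (actRow k γ i r : ℤ) - r - 1 := by
    rw [← rowLen_act hk]
    rfl
  rw [h]
  unfold actRow
  split_ifs with a b
  · have := rowLen_pos_of_not_isBead a.2
    unfold beadPos
    omega
  · unfold beadPos
    push_cast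
    ring
  · rfl

/-- The simple reflection `s_i` of the integers. -/
noncomputable def refl (k : ℕ) (i : ZMod (k + 1)) (x : ℤ) : ℤ :=
  if (x : ZMod (k + 1)) = i then x - 1
  else if ((x + 1 : ℤ) : ZMod (k + 1)) = i then x + 1 else x

lemma refl_of_eq {k : ℕ} {i : ZMod (k + 1)} {x : ℤ} (h : (x : ZMod (k + 1)) = i) :
    refl k i x = x - 1 := by simp [refl, h]

lemma refl_of_add_one_eq {k : ℕ} (hk : 1 ≤ k) {i : ZMod (k + 1)} {x : ℤ}
    (h : ((x + 1 : ℤ) : ZMod (k + 1)) = i) : refl k i x = x + 1 := by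
  unfold refl
  rw [if_neg fun h' => intCast_sub_one_ne hk h' h, if_pos h]

lemma refl_of_ne {k : ℕ} {i : ZMod (k + 1)} {x : ℤ} (h : (x : ZMod (k + 1)) ≠ i)
    (h' : ((x + 1 : ℤ) : ZMod (k + 1)) ≠ i) : refl k i x = x := by
  unfold refl
  rw [if_neg h, if_neg h']

lemma refl_refl {k : ℕ} (hk : 1 ≤ k) (i : ZMod (k + 1)) (x : ℤ) :
    refl k i (refl k i x) = x := by
  by_cases h : (x : ZMod (k + 1)) = i
  · rw [refl_of_eq h, refl_of_add_one_eq hk (by simpa using h)]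
    ring
  · by_cases h' : ((x + 1 : ℤ) : ZMod (k + 1)) = i
    · rw [refl_of_add_one_eq hk h', refl_of_eq h']
      ring
    · rw [refl_of_ne h h', refl_of_ne h h']

lemma refl_sub (k : ℕ) (i : ZMod (k + 1)) (x : ℤ) :
    refl k i (x - (k + 1 : ℕ)) = refl k i x - (k + 1 : ℕ) := by
  have e1 : ((x - (k + 1 : ℕ) : ℤ) : ZMod (k + 1)) = x := by
    rw [Int.cast_sub, Int.cast_natCast, ZMod.natCast_self, sub_zero]
  have e2 : ((x - (k + 1 : ℕ) + 1 : ℤ) : ZMod (k + 1)) = ((x + 1 : ℤ) : ZMod (k + 1)) := by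
    rw [Int.cast_add, e1, Int.cast_add]
  unfold refl
  rw [e1, e2]
  split_ifs <;> ring

lemma isBead_act {k : ℕ} (hk : 1 ≤ k) (γ : YoungDiagram) (i : ZMod (k + 1)) (x : ℤ) :
    IsBead (act hk γ i) x ↔ IsBead γ (refl k i x) := by
  constructor
  · rintro ⟨r, hr⟩
    rw [beadPos_act] at hr
    split_ifs at hr with a b
    · rw [← hr, refl_of_add_one_eq hk (by simpa using a.1)]
      exact ⟨r, by ring⟩
    · rw [← hr, refl_of_eq b.1]
      exact ⟨r, by ring⟩
    · rw [← hr]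
      by_cases h : (beadPos γ r : ZMod (k + 1)) = i
      · rw [refl_of_eq h]
        by_contra h'
        exact a ⟨h, h'⟩
      · by_cases h2 : ((beadPos γ r + 1 : ℤ) : ZMod (k + 1)) = i
        · rw [refl_of_add_one_eq hk h2]
          by_contra h'
          exact b ⟨h2, h'⟩
        · rw [refl_of_ne h h2]
          exact ⟨r, rfl⟩
  · intro hb
    have fixed : ∀ r, beadPos γ r = x → IsBead γ (refl k i x) → IsBead (act hk γ i) x := by
      rintro r rfl hb'
      refine ⟨r, ?_⟩
      rw [beadPos_act]
      split_ifs with a b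
      · exact absurd (refl_of_eq a.1 ▸ hb') a.2
      · exact absurd (refl_of_add_one_eq hk b.1 ▸ hb') b.2
      · rfl
    by_cases hx : IsBead γ x
    · obtain ⟨r, hr⟩ := hx
      exact fixed r hr hb
    obtain ⟨r, hr⟩ := hb
    refine ⟨r, ?_⟩
    rw [beadPos_act, hr]
    by_cases h : (x : ZMod (k + 1)) = i
    · rw [refl_of_eq h] at hr ⊢
      rw [if_neg fun h' => intCast_sub_one_ne hk h'.1 (by simpa using h),
        if_pos ⟨by simpa using h, by simpa using hx⟩]
      ring
    · by_cases h2 : ((x + 1 : ℤ) : ZMod (k + 1)) = i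
      · rw [refl_of_add_one_eq hk h2] at hr ⊢
        rw [if_pos ⟨h2, by simpa using hx⟩]
        ring
      · rw [refl_of_ne h h2] at hr
        exact absurd ⟨r, hr⟩ hx

lemma IsCore.core_act {k : ℕ} (hk : 1 ≤ k) {γ : YoungDiagram} (h : IsCore (k + 1) γ)
    (i : ZMod (k + 1)) : IsCore (k + 1) (act hk γ i) := by
  rw [isCore_iff (Nat.succ_pos k)] at h ⊢
  intro x hx
  rw [isBead_act] at hx ⊢
  rw [refl_sub]
  exact h _ hx

lemma eq_of_isBead_iff {γ γ' : YoungDiagram} (h : ∀ x, IsBead γ x ↔ IsBead γ' x) : γ = γ' := by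
  have key : ∀ r, beadPos γ r = beadPos γ' r := by
    have aux : ∀ (μ ν : YoungDiagram), (∀ x, IsBead μ x → IsBead ν x) → ∀ r,
        (∀ r' < r, beadPos μ r' = beadPos ν r') → beadPos μ r ≤ beadPos ν r := by
      intro μ ν hs r ih
      obtain ⟨s, hsr⟩ := hs _ ⟨r, rfl⟩
      rw [← hsr, (beadPos_strictAnti ν).le_iff_ge]
      by_contra hcon
      have := (beadPos_strictAnti μ).injective ((ih s (not_le.1 hcon)).trans hsr)
      omega
    intro r
    induction r using Nat.strong_induction_on with
    | _ r ih =>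
      exact le_antisymm (aux γ γ' (fun x => (h x).1) r ih)
        (aux γ' γ (fun x => (h x).2) r fun s hs => (ih s hs).symm)
  ext ⟨a, b⟩
  have := key a
  unfold beadPos at this
  rw [YoungDiagram.mem_cells, YoungDiagram.mem_cells, YoungDiagram.mem_iff_lt_rowLen,
    YoungDiagram.mem_iff_lt_rowLen]
  omega

lemma act_act {k : ℕ} (hk : 1 ≤ k) (γ : YoungDiagram) (i : ZMod (k + 1)) :
    act hk (act hk γ i) i = γ :=
  eq_of_isBead_iff fun x => by rw [isBead_act, isBead_act, refl_refl hk]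

/-! ## Removing all corners of one residue from a core -/

lemma gapCount_act {k : ℕ} (hk : 1 ≤ k) (γ : YoungDiagram) (i : ZMod (k + 1)) {x : ℤ}
    (hx : ((x + 1 : ℤ) : ZMod (k + 1)) ≠ i) :
    gapCount k (act hk γ i) x = gapCount k γ x := by
  have hxk : ((x - k : ℤ) : ZMod (k + 1)) ≠ i := by
    rwa [show x - (k : ℤ) = (x + 1) - ((k + 1 : ℕ) : ℤ) by push_cast; ring, Int.cast_sub,
      Int.cast_natCast, ZMod.natCast_self, sub_zero]
  have hwin : ∀ t ∈ Finset.Icc (x - k) x, refl k i t ∈ Finset.Icc (x - k) x := by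
    intro t ht
    rw [Finset.mem_Icc] at ht ⊢
    by_cases h : (t : ZMod (k + 1)) = i
    · have : t ≠ x - k := by
        rintro rfl
        exact hxk h
      rw [refl_of_eq h]
      omega
    · by_cases h2 : ((t + 1 : ℤ) : ZMod (k + 1)) = i
      · have : t ≠ x := by
          rintro rfl
          exact hx h2
        rw [refl_of_add_one_eq hk h2]
        omega
      · rwa [refl_of_ne h h2]
  unfold gapCount
  refine Finset.card_bij (fun t _ => refl k i t) ?_ ?_ ?_
  · intro t ht
    rw [Finset.mem_filter, isBead_act] at ht
    rw [Finset.mem_filter]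
    exact ⟨hwin t ht.1, ht.2⟩
  · intro t _ t' _ h
    rw [← refl_refl hk i t, h, refl_refl hk]
  · intro t ht
    rw [Finset.mem_filter] at ht
    refine ⟨refl k i t, ?_, refl_refl hk i t⟩
    rw [Finset.mem_filter, isBead_act, refl_refl hk]
    exact ⟨hwin t ht.1, ht.2⟩

/-- Remove all removable corners of residue `i`. -/
noncomputable def removeCorners (k : ℕ) (γ : YoungDiagram) (i : ZMod (k + 1)) : YoungDiagram where
  cells := γ.cells.filter fun c => ¬ (Removable γ c ∧ residue k c = i)
  isLowerSet := by
    rintro ⟨a, b⟩ ⟨a', b'⟩ hle h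
    simp only [Finset.coe_filter, YoungDiagram.mem_cells, Set.mem_ofPred_eq] at h ⊢
    have hmem : (a', b') ∈ γ := γ.up_left_mem (Prod.mk_le_mk.1 hle).1 (Prod.mk_le_mk.1 hle).2 h.1
    refine ⟨hmem, ?_⟩
    rintro ⟨⟨_, h1, h2⟩, hres⟩
    obtain ⟨h3, h4⟩ := Prod.mk_le_mk.1 hle
    rcases Nat.lt_or_ge a' a with hlt | hge
    · exact h1 (γ.up_left_mem hlt h4 h.1)
    rcases Nat.lt_or_ge b' b with hlt | hge'
    · exact h2 (γ.up_left_mem h3 hlt h.1)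
    obtain rfl : a = a' := by omega
    obtain rfl : b = b' := by omega
    exact h.2 ⟨⟨hmem, h1, h2⟩, hres⟩

lemma mem_removeCorners {k : ℕ} {γ : YoungDiagram} {i : ZMod (k + 1)} {c : ℕ × ℕ} :
    c ∈ removeCorners k γ i ↔ c ∈ γ ∧ ¬ (Removable γ c ∧ residue k c = i) := by
  rw [← YoungDiagram.mem_cells]
  simp [removeCorners]

lemma IsCore.isBead_add_one {k : ℕ} {γ : YoungDiagram} (h : IsCore (k + 1) γ) {i : ZMod (k + 1)}
    {y : ℤ} (hy : IsBead γ y) (hy' : ¬ IsBead γ (y - 1)) (hyi : (y : ZMod (k + 1)) = i) {x : ℤ}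
    (hx : IsBead γ x) (hxi : ((x + 1 : ℤ) : ZMod (k + 1)) = i) : IsBead γ (x + 1) := by
  rcases le_or_gt (x + 1) y with hle | hlt
  · exact h.isBead_of_le hy hle (hxi.trans hyi.symm)
  · refine absurd (h.isBead_of_le hx (y := y - 1) (by omega) ?_) hy'
    rw [← hyi] at hxi
    push_cast at hxi ⊢
    rw [← hxi]
    ring

lemma Removable.exists_bead {k : ℕ} {γ : YoungDiagram} {i : ZMod (k + 1)} {c : ℕ × ℕ}
    (hc : Removable γ c) (hci : residue k c = i) :
    ¬ IsBead γ (beadPos γ c.1 - 1) ∧ (beadPos γ c.1 : ZMod (k + 1)) = i := by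
  obtain ⟨a, b⟩ := c
  rw [removable_iff] at hc
  exact ⟨hc.2, by rw [← hci, residue_eq_of_add_one k γ hc.1]⟩

lemma exists_removable {k : ℕ} {γ : YoungDiagram} {r : ℕ} (h : ¬ IsBead γ (beadPos γ r - 1)) :
    Removable γ (r, γ.rowLen r - 1) ∧
      residue k (r, γ.rowLen r - 1) = (beadPos γ r : ZMod (k + 1)) := by
  have hpos := rowLen_pos_of_not_isBead h
  have h1 : γ.rowLen r - 1 + 1 = γ.rowLen r := by omega
  exact ⟨(removable_iff γ r _).2 ⟨h1, h⟩, residue_eq_of_add_one k γ h1⟩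

lemma IsCore.actRow_eq {k : ℕ} {γ : YoungDiagram} (h : IsCore (k + 1) γ) {i : ZMod (k + 1)}
    {c : ℕ × ℕ} (hc : Removable γ c) (hci : residue k c = i) (r : ℕ) :
    actRow k γ i r = if (beadPos γ r : ZMod (k + 1)) = i ∧ ¬ IsBead γ (beadPos γ r - 1) then
      γ.rowLen r - 1 else γ.rowLen r := by
  obtain ⟨h1, h2⟩ := hc.exists_bead hci
  unfold actRow
  split_ifs with a b
  · rfl
  · exact absurd (h.isBead_add_one ⟨_, rfl⟩ h1 h2 ⟨r, rfl⟩ b.1) b.2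
  · rfl

lemma IsCore.act_eq_removeCorners {k : ℕ} (hk : 1 ≤ k) {γ : YoungDiagram}
    (h : IsCore (k + 1) γ) {i : ZMod (k + 1)} {c : ℕ × ℕ} (hc : Removable γ c)
    (hci : residue k c = i) : act hk γ i = removeCorners k γ i := by
  ext ⟨a, b⟩
  rw [YoungDiagram.mem_cells, YoungDiagram.mem_cells, mem_removeCorners, removable_iff,
    YoungDiagram.mem_iff_lt_rowLen, YoungDiagram.mem_iff_lt_rowLen, rowLen_act,
    h.actRow_eq hc hci]
  by_cases hab : b + 1 = γ.rowLen a
  · rw [residue_eq_of_add_one k γ hab]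
    split_ifs with hh
    · simp only [hab, hh, not_true_eq_false, not_false_eq_true, and_self, and_false, iff_false]
      omega
    · have : ¬ ((b + 1 = γ.rowLen a ∧ ¬ IsBead γ (beadPos γ a - 1)) ∧
          (beadPos γ a : ZMod (k + 1)) = i) := fun h' => hh ⟨h'.2, h'.1.2⟩
      tauto
  · split_ifs with hh
    · simp only [hab, false_and, not_false_eq_true, and_true]
      omega
    · simp only [hab, false_and, not_false_eq_true, and_true]

lemma IsCore.core_removeCorners {k : ℕ} (hk : 1 ≤ k) {γ : YoungDiagram} (h : IsCore (k + 1) γ)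
    (i : ZMod (k + 1)) : IsCore (k + 1) (removeCorners k γ i) := by
  by_cases hex : ∃ c, Removable γ c ∧ residue k c = i
  · obtain ⟨c, hc, hci⟩ := hex
    rw [← h.act_eq_removeCorners hk hc hci]
    exact h.core_act hk i
  · have : removeCorners k γ i = γ := by
      ext c
      rw [YoungDiagram.mem_cells, YoungDiagram.mem_cells, mem_removeCorners]
      exact ⟨fun h => h.1, fun h => ⟨h, fun h' => hex ⟨c, h'⟩⟩⟩
    rwa [this]

/-- Removing the corners of residue `i` from a core decreases only the row of `𝔭` indexed by the
last row containing such a corner, and by exactly one. -/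
lemma IsCore.exists_pRow_removeCorners {k : ℕ} (hk : 1 ≤ k) {γ : YoungDiagram}
    (h : IsCore (k + 1) γ) {i : ZMod (k + 1)} {c : ℕ × ℕ} (hc : Removable γ c)
    (hci : residue k c = i) :
    ∃ d : ℕ × ℕ, Removable γ d ∧ residue k d = i ∧
      (∀ d', Removable γ d' → residue k d' = i → d'.1 ≤ d.1) ∧
      ∀ r, pRow k γ r = pRow k (removeCorners k γ i) r + if r = d.1 then 1 else 0 := by
  obtain ⟨d, hd, hmax⟩ := (γ.cells.filter fun c => Removable γ c ∧ residue k c = i).exists_max_image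
    Prod.fst ⟨c, by simp [hc, hci, hc.1]⟩
  simp only [Finset.mem_filter, YoungDiagram.mem_cells] at hd hmax
  have hmax' : ∀ d', Removable γ d' → residue k d' = i → d'.1 ≤ d.1 :=
    fun d' h1 h2 => hmax d' ⟨h1.1, h1, h2⟩
  refine ⟨d, hd.2.1, hd.2.2, hmax', fun r => ?_⟩
  obtain ⟨hd1, hd2⟩ := hd.2.1.exists_bead hd.2.2
  have hcore := (isCore_iff (Nat.succ_pos k) γ).1 h
  rw [← h.act_eq_removeCorners hk hc hci, pRow_eq_gapCount, pRow_eq_gapCount]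
  set s := beadPos γ r with hs
  have hsb : IsBead γ s := ⟨r, rfl⟩
  have hcast : ∀ x : ℤ, ((x - ((k + 1 : ℕ) : ℤ) : ℤ) : ZMod (k + 1)) = x := fun x => by
    rw [Int.cast_sub, Int.cast_natCast, ZMod.natCast_self, sub_zero]
  have hrow : beadPos (act hk γ i) r = if (s : ZMod (k + 1)) = i ∧ ¬ IsBead γ (s - 1) then s - 1
      else s := by
    rw [beadPos_act]
    split_ifs with a b
    · rfl
    · exact absurd (h.isBead_add_one ⟨_, rfl⟩ hd1 hd2 ⟨r, rfl⟩ b.1) b.2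
    · rfl
  rw [hrow]
  split_ifs with a b b
  · -- the row with the last corner of residue `i`
    have e := gapCount_succ k (act hk γ i) (s - 1)
    rw [show s - 1 + 1 = s by ring, show s - 1 - (k : ℤ) = s - ((k + 1 : ℕ) : ℤ) by push_cast; ring,
      gapCount_act hk γ i (intCast_sub_one_ne hk a.1), isBead_act, isBead_act, refl_of_eq a.1,
      refl_of_eq ((hcast s).trans a.1), if_neg a.2] at e
    have hb : IsBead γ (s - ((k + 1 : ℕ) : ℤ) - 1) := by
      obtain ⟨r', hr'⟩ := hcore s hsb
      by_contra hcon
      rw [← hr'] at hcon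
      obtain ⟨h1, h2⟩ := exists_removable (k := k) hcon
      have h3 := hmax' _ h1 (by rw [h2, hr', hcast, a.1])
      have h4 : r < r' := (beadPos_strictAnti γ).lt_iff_gt.1 (by omega)
      simp only at h3
      omega
    rw [if_pos hb] at e
    omega
  · have e := gapCount_succ k (act hk γ i) (s - 1)
    rw [show s - 1 + 1 = s by ring, show s - 1 - (k : ℤ) = s - ((k + 1 : ℕ) : ℤ) by push_cast; ring,
      gapCount_act hk γ i (intCast_sub_one_ne hk a.1), isBead_act, isBead_act, refl_of_eq a.1,
      refl_of_eq ((hcast s).trans a.1), if_neg a.2] at e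
    have hb : ¬ IsBead γ (s - ((k + 1 : ℕ) : ℤ) - 1) := by
      intro hcon
      obtain ⟨h1, h2⟩ := exists_removable (k := k) a.2
      have h3 := hmax' _ h1 (by rw [h2, a.1])
      simp only at h3
      have h4 : beadPos γ d.1 < s := beadPos_strictAnti γ (by omega)
      have h5 : beadPos γ d.1 ≤ s - ((k + 1 : ℕ) : ℤ) := by
        obtain ⟨m, hm⟩ := (ZMod.intCast_eq_intCast_iff_dvd_sub (beadPos γ d.1) s (k + 1)).1
          (hd2.trans a.1.symm)
        have : 0 < m := by
          by_contra hneg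
          have : ((k + 1 : ℕ) : ℤ) * m ≤ 0 := mul_nonpos_of_nonneg_of_nonpos (by positivity) (by omega)
          omega
        have : ((k + 1 : ℕ) : ℤ) * 1 ≤ ((k + 1 : ℕ) : ℤ) * m :=
          mul_le_mul_of_nonneg_left (by omega) (by positivity)
        omega
      refine hd1 (h.isBead_of_le hcon (by omega) ?_)
      rw [Int.cast_sub, Int.cast_sub, hcast, hd2, a.1]
    rw [if_neg hb] at e
    omega
  · exfalso
    subst b
    exact a ⟨hd2, hd1⟩
  · rw [add_zero]
    by_cases hs1 : ((s + 1 : ℤ) : ZMod (k + 1)) = i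
    · have hb1 : IsBead γ (s + 1) := h.isBead_add_one ⟨_, rfl⟩ hd1 hd2 hsb hs1
      have e1 := gapCount_succ k γ s
      have e2 := gapCount_succ k (act hk γ i) s
      have hsk : s - (k : ℤ) = s + 1 - ((k + 1 : ℕ) : ℤ) := by push_cast; ring
      rw [isBead_act, isBead_act, refl_of_eq hs1, hsk, refl_of_eq ((hcast _).trans hs1),
        gapCount_act hk γ i (intCast_sub_one_ne hk hs1), if_pos, if_pos (by simpa using hsb)] at e2
      · rw [hsk, if_pos hb1, if_pos (hcore _ hb1)] at e1
        omega
      · have := hcore _ hsb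
        rwa [show s + 1 - ((k + 1 : ℕ) : ℤ) - 1 = s - ((k + 1 : ℕ) : ℤ) by ring]
    · rw [gapCount_act hk γ i hs1]

lemma IsCore.mem_of_addable_removeCorners {k : ℕ} (hk : 1 ≤ k) {γ : YoungDiagram}
    (h : IsCore (k + 1) γ) {i : ZMod (k + 1)} {c : ℕ × ℕ} (hc : Removable γ c)
    (hci : residue k c = i) {d : ℕ × ℕ} (hd : Addable (removeCorners k γ i) d)
    (hdi : residue k d = i) : d ∈ γ := by
  obtain ⟨r, c'⟩ := d
  rw [← h.act_eq_removeCorners hk hc hci] at hd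
  rw [addable_iff] at hd
  obtain ⟨rfl, hd⟩ := hd
  rw [residue_rowLen] at hdi
  rw [isBead_act, refl_of_eq hdi] at hd
  rw [YoungDiagram.mem_iff_lt_rowLen]
  have h1 := rowLen_act hk γ i r
  rw [h.actRow_eq hc hci] at h1
  split_ifs at h1 with a
  · have := rowLen_pos_of_not_isBead a.2
    omega
  · exact absurd ⟨r, by unfold beadPos; omega⟩ hd

/-- Adding corners to a core: a core with an addable corner `d` arises from a core having `d` as
removable corner by removing all corners of the residue of `d`. -/
lemma IsCore.exists_removeCorners_eq {k : ℕ} (hk : 1 ≤ k) {γ : YoungDiagram}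
    (h : IsCore (k + 1) γ) {d : ℕ × ℕ} (hd : Addable γ d) :
    ∃ γ' : YoungDiagram, IsCore (k + 1) γ' ∧ Removable γ' d ∧
      removeCorners k γ' (residue k d) = γ := by
  obtain ⟨r, c⟩ := d
  rw [addable_iff] at hd
  obtain ⟨rfl, hd⟩ := hd
  rw [residue_rowLen]
  set i : ZMod (k + 1) := ((beadPos γ r + 1 : ℤ) : ZMod (k + 1)) with hi
  have hne : (beadPos γ r : ZMod (k + 1)) ≠ i := fun h' => intCast_sub_one_ne hk h' rfl
  have hlen : (act hk γ i).rowLen r = γ.rowLen r + 1 := by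
    rw [rowLen_act]
    unfold actRow
    rw [if_neg fun h' => hne h'.1, if_pos ⟨rfl, hd⟩]
  have hpos : beadPos (act hk γ i) r = beadPos γ r + 1 := by
    unfold beadPos
    omega
  have hrem : Removable (act hk γ i) (r, γ.rowLen r) := by
    rw [removable_iff, hpos, isBead_act, add_sub_cancel_right, refl_of_add_one_eq hk rfl]
    exact ⟨hlen.symm, hd⟩
  refine ⟨act hk γ i, h.core_act hk i, hrem, ?_⟩
  rw [← (h.core_act hk i).act_eq_removeCorners hk hrem (residue_rowLen k γ r), act_act]

lemma pRow_eq_zero {k : ℕ} {γ : YoungDiagram} {r : ℕ} (h : γ.rowLen r = 0) : pRow k γ r = 0 := by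
  unfold pRow
  rw [Finset.card_eq_zero, Finset.filter_eq_empty_iff]
  rintro ⟨a, b⟩ hm ⟨ha, _⟩
  rw [YoungDiagram.mem_cells, YoungDiagram.mem_iff_lt_rowLen] at hm
  simp only at ha
  subst ha
  omega

lemma pRow_le_rowLen (k : ℕ) (γ : YoungDiagram) (r : ℕ) : pRow k γ r ≤ γ.rowLen r := by
  rw [YoungDiagram.rowLen_eq_card]
  unfold pRow YoungDiagram.row
  apply Finset.card_le_card
  intro c
  simp only [Finset.mem_filter]
  tauto

lemma pSize_eq_sum (k : ℕ) {γ : YoungDiagram} {M : ℕ} (h : γ.rowLen M = 0) :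
    pSize k γ = ∑ r ∈ Finset.range M, pRow k γ r := by
  unfold pSize pRow
  rw [Finset.card_eq_sum_card_fiberwise (f := Prod.fst) (t := Finset.range M)]
  · refine Finset.sum_congr rfl fun r _ => ?_
    congr 1
    ext c
    simp only [Finset.mem_filter]
    tauto
  · rintro ⟨a, b⟩ hm
    simp only [Finset.coe_filter, Set.mem_ofPred_eq, YoungDiagram.mem_cells,
      YoungDiagram.mem_iff_lt_rowLen] at hm
    simp only [Finset.coe_range, Set.mem_Iio]
    by_contra hcon
    have := γ.rowLen_anti M a (by omega)
    omega

lemma IsCore.pSize_removeCorners {k : ℕ} (hk : 1 ≤ k) {γ : YoungDiagram}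
    (h : IsCore (k + 1) γ) {i : ZMod (k + 1)} {c : ℕ × ℕ} (hc : Removable γ c)
    (hci : residue k c = i) : pSize k γ = pSize k (removeCorners k γ i) + 1 := by
  obtain ⟨d, hd, hdi, -, hrow⟩ := h.exists_pRow_removeCorners hk hc hci
  have h0 : γ.rowLen (γ.colLen 0) = 0 := (rowLen_eq_zero_iff γ _).2 le_rfl
  have h1 : (removeCorners k γ i).rowLen (γ.colLen 0) = 0 := by
    by_contra hne
    have := YoungDiagram.mem_iff_lt_rowLen.2 (Nat.pos_of_ne_zero hne)
    have := YoungDiagram.mem_iff_lt_rowLen.1 (mem_removeCorners.1 this).1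
    omega
  rw [pSize_eq_sum k h0, pSize_eq_sum k h1, Finset.sum_congr rfl fun r _ => hrow r,
    Finset.sum_add_distrib, Finset.sum_ite_eq', if_pos]
  rw [Finset.mem_range]
  have h2 : (d.1, 0) ∈ γ := γ.up_left_mem le_rfl (Nat.zero_le _) hd.1
  exact YoungDiagram.mem_iff_lt_colLen.1 h2

/-! ## Chains of diagrams growing one residue at a time -/

lemma residue_right_ne {k : ℕ} (hk : 1 ≤ k) (r c : ℕ) :
    residue k (r, c + 1) ≠ residue k (r, c) := by
  intro h
  apply ZMod.one_ne_zero_of_pos hk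
  unfold residue at h
  push_cast at h
  linear_combination h

lemma residue_above_ne {k : ℕ} (hk : 1 ≤ k) (r c : ℕ) :
    residue k (r + 1, c) ≠ residue k (r, c) := by
  intro h
  apply ZMod.one_ne_zero_of_pos hk
  unfold residue at h
  push_cast at h
  linear_combination -h

lemma pSize_bot (k : ℕ) : pSize k ⊥ = 0 := by
  simp [pSize]

/-- `δ ⊆ δ'` and all cells of `δ' \ δ` have residue `i`. -/
def ResStep (k : ℕ) (i : ZMod (k + 1)) (δ δ' : YoungDiagram) : Prop :=
  δ ≤ δ' ∧ ∀ c ∈ δ', c ∉ δ → residue k c = i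

lemma ResStep.removable {k : ℕ} (hk : 1 ≤ k) {i : ZMod (k + 1)} {δ δ' : YoungDiagram}
    (h : ResStep k i δ δ') {c : ℕ × ℕ} (hc : c ∈ δ') (hc' : c ∉ δ) : Removable δ' c := by
  obtain ⟨a, b⟩ := c
  refine ⟨hc, fun hup => ?_, fun hright => ?_⟩
  · refine residue_above_ne hk a b ((h.2 _ hup fun h' => ?_).trans (h.2 _ hc hc').symm)
    exact hc' (δ.up_left_mem (Nat.le_succ a) le_rfl h')
  · refine residue_right_ne hk a b ((h.2 _ hright fun h' => ?_).trans (h.2 _ hc hc').symm)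
    exact hc' (δ.up_left_mem le_rfl (Nat.le_succ b) h')

lemma ResStep.addable {k : ℕ} (hk : 1 ≤ k) {i : ZMod (k + 1)} {δ δ' : YoungDiagram}
    (h : ResStep k i δ δ') {c : ℕ × ℕ} (hc : c ∈ δ') (hc' : c ∉ δ) : Addable δ c := by
  obtain ⟨a, b⟩ := c
  refine ⟨hc', ?_⟩
  rintro ⟨a', b'⟩ hle hne
  obtain ⟨h1, h2⟩ := Prod.mk_le_mk.1 hle
  rcases Nat.lt_or_ge a' a with hlt | hge
  · obtain ⟨m, rfl⟩ : ∃ m, a = m + 1 := ⟨a - 1, by omega⟩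
    refine δ.up_left_mem (i2 := m) (by omega) h2 ?_
    by_contra hcon
    exact residue_above_ne hk m b ((h.2 _ hc hc').trans
      (h.2 _ (δ'.up_left_mem (Nat.le_succ m) le_rfl hc) hcon).symm)
  · obtain rfl : a = a' := by omega
    have hlt : b' < b := lt_of_le_of_ne h2 fun h => hne (by rw [h])
    obtain ⟨m, rfl⟩ : ∃ m, b = m + 1 := ⟨b - 1, by omega⟩
    refine δ.up_left_mem (j2 := m) h1 (by omega) ?_
    by_contra hcon
    exact residue_right_ne hk a m ((h.2 _ hc hc').trans
      (h.2 _ (δ'.up_left_mem le_rfl (Nat.le_succ m) hc) hcon).symm)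

/-- A chain of diagrams from `∅` growing by one residue at a time, whose length is the `𝔭`-size of
the core at its end, consists of cores, each obtained from the next by removing all corners of one
residue. -/
theorem chain_eq_removeCorners {k : ℕ} (hk : 1 ≤ k) {β : ℕ → YoungDiagram}
    {i : ℕ → ZMod (k + 1)} (h0 : β 0 = ⊥) (n : ℕ) :
    ∀ γ : YoungDiagram, IsCore (k + 1) γ → n ≤ pSize k γ → γ ≤ β n →
      (∀ y < n, ResStep k (i y) (β y) (β (y + 1))) →
      β n = γ ∧ (∀ y ≤ n, IsCore (k + 1) (β y) ∧ pSize k (β y) = y) ∧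
      ∀ y < n, β y = removeCorners k (β (y + 1)) (i y) ∧
        ∃ c, Removable (β (y + 1)) c ∧ residue k c = i y := by
  induction n with
  | zero =>
    intro γ hγ _ hle _
    rw [h0] at hle
    obtain rfl : γ = ⊥ := le_bot_iff.1 hle
    refine ⟨h0, fun y hy => ?_, fun y hy => absurd hy (Nat.not_lt_zero y)⟩
    obtain rfl : y = 0 := by omega
    rw [h0]
    exact ⟨hγ, pSize_bot k⟩
  | succ n ih =>
    intro γ hγ hn hle hstep
    have hst := hstep n (Nat.lt_succ_self n)
    have hsub : removeCorners k γ (i n) ≤ β n := by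
      intro c hc
      rw [mem_removeCorners] at hc
      by_contra hcon
      have hcβ : c ∈ β (n + 1) := hle hc.1
      have hr := hst.removable hk hcβ hcon
      exact hc.2 ⟨⟨hc.1, fun h => hr.2.1 (hle h), fun h => hr.2.2 (hle h)⟩,
        hst.2 c hcβ hcon⟩
    by_cases hex : ∃ c, Removable γ c ∧ residue k c = i n
    · obtain ⟨c, hc, hci⟩ := hex
      have hsz := hγ.pSize_removeCorners hk hc hci
      obtain ⟨e1, e2, e3⟩ := ih _ (hγ.core_removeCorners hk (i n)) (by omega) hsub
        fun y hy => hstep y (by omega)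
      have heq : β (n + 1) = γ := by
        refine le_antisymm (fun d hd => ?_) hle
        by_contra hcon
        have hdn : d ∉ β n := by
          rw [e1, mem_removeCorners]
          exact fun h => hcon h.1
        refine hcon (hγ.mem_of_addable_removeCorners hk hc hci (d := d) ?_ (hst.2 d hd hdn))
        rw [← e1]
        exact hst.addable hk hd hdn
      refine ⟨heq, fun y hy => ?_, fun y hy => ?_⟩
      · rcases Nat.lt_or_ge n y with h | h
        · obtain rfl : y = n + 1 := by omega
          rw [heq]
          refine ⟨hγ, ?_⟩
          have := (e2 n le_rfl).2
          rw [e1] at this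
          omega
        · exact e2 y h
      · rcases Nat.lt_or_ge y n with h | h
        · exact e3 y h
        · obtain rfl : y = n := by omega
          rw [heq]
          exact ⟨e1, c, hc, hci⟩
    · exfalso
      have hrem : removeCorners k γ (i n) = γ := by
        ext c
        rw [YoungDiagram.mem_cells, YoungDiagram.mem_cells, mem_removeCorners]
        exact ⟨fun h => h.1, fun h => ⟨h, fun h' => hex ⟨c, h'⟩⟩⟩
      rw [hrem] at hsub
      obtain ⟨e1, e2, -⟩ := ih γ hγ (by omega) hsub fun y hy => hstep y (by omega)
      have := (e2 n le_rfl).2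
      rw [e1] at this
      omega

lemma IsCore.pRow_removeCorners_le {k : ℕ} (hk : 1 ≤ k) {γ : YoungDiagram}
    (h : IsCore (k + 1) γ) {i : ZMod (k + 1)} {c : ℕ × ℕ} (hc : Removable γ c)
    (hci : residue k c = i) (r : ℕ) : pRow k (removeCorners k γ i) r ≤ pRow k γ r := by
  obtain ⟨d, -, -, -, hrow⟩ := h.exists_pRow_removeCorners hk hc hci
  rw [hrow r]
  omega

/-! ## Labelings of a core by residues -/

/-- The largest subdiagram of `γ` all of whose cells have a label at most `y`. -/
noncomputable def lowShape (γ : YoungDiagram) (L : ℕ × ℕ → ℕ) (y : ℕ) : YoungDiagram where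
  cells := γ.cells.filter fun c => ∀ d ≤ c, L d ≤ y
  isLowerSet := by
    rintro a b hle h
    simp only [Finset.coe_filter, YoungDiagram.mem_cells, Set.mem_ofPred_eq] at h ⊢
    exact ⟨γ.isLowerSet hle h.1, fun d hd => h.2 d (hd.trans hle)⟩

/-- A labeling of `γ` with labels `1, …, n` which is weakly increasing along rows and columns and
whose labels determine residues. -/
structure IsResLabeling (k n : ℕ) (γ : YoungDiagram) (L : ℕ × ℕ → ℕ) : Prop where
  zero : ∀ c, c ∉ γ → L c = 0
  pos : ∀ c ∈ γ, 1 ≤ L c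
  le : ∀ c ∈ γ, L c ≤ n
  row : ∀ r c, (r, c + 1) ∈ γ → L (r, c) ≤ L (r, c + 1)
  col : ∀ r c, (r + 1, c) ∈ γ → L (r, c) ≤ L (r + 1, c)
  res : ∀ c ∈ γ, ∀ d ∈ γ, L c = L d → residue k c = residue k d

lemma label_mono {γ : YoungDiagram} {L : ℕ × ℕ → ℕ}
    (row : ∀ r c, (r, c + 1) ∈ γ → L (r, c) ≤ L (r, c + 1))
    (col : ∀ r c, (r + 1, c) ∈ γ → L (r, c) ≤ L (r + 1, c)) {c d : ℕ × ℕ} (hd : d ≤ c)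
    (hc : c ∈ γ) : L d ≤ L c := by
  obtain ⟨a, b⟩ := c
  obtain ⟨a', b'⟩ := d
  obtain ⟨h1, h2⟩ := Prod.mk_le_mk.1 hd
  have e1 : ∀ m, a' ≤ m → m ≤ a → L (a', b) ≤ L (m, b) := by
    intro m hm
    induction m, hm using Nat.le_induction with
    | base => exact fun _ => le_rfl
    | succ m hm ih =>
      intro hma
      exact (ih (by omega)).trans (col m b (γ.up_left_mem hma le_rfl hc))
  have e2 : ∀ m, b' ≤ m → m ≤ b → L (a', b') ≤ L (a', m) := by
    intro m hm
    induction m, hm using Nat.le_induction with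
    | base => exact fun _ => le_rfl
    | succ m hm ih =>
      intro hmb
      exact (ih (by omega)).trans (row a' m (γ.up_left_mem h1 hmb hc))
  exact (e2 b h2 le_rfl).trans (e1 a h1 le_rfl)

lemma mem_lowShape {γ : YoungDiagram} {L : ℕ × ℕ → ℕ}
    (mono : ∀ c d : ℕ × ℕ, d ≤ c → c ∈ γ → L d ≤ L c) {y : ℕ} {c : ℕ × ℕ} :
    c ∈ lowShape γ L y ↔ c ∈ γ ∧ L c ≤ y := by
  rw [← YoungDiagram.mem_cells]
  simp only [lowShape, Finset.mem_filter, YoungDiagram.mem_cells]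
  exact ⟨fun h => ⟨h.1, h.2 c le_rfl⟩, fun h => ⟨h.1, fun d hd => (mono c d hd h.1).trans h.2⟩⟩

namespace IsResLabeling

variable {k n : ℕ} {γ : YoungDiagram} {L : ℕ × ℕ → ℕ}

lemma mono (hL : IsResLabeling k n γ L) (c d : ℕ × ℕ) (hd : d ≤ c) (hc : c ∈ γ) : L d ≤ L c :=
  label_mono hL.row hL.col hd hc

lemma mem_lowShape (hL : IsResLabeling k n γ L) {y : ℕ} {c : ℕ × ℕ} :
    c ∈ lowShape γ L y ↔ c ∈ γ ∧ L c ≤ y :=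
  AffineKTheory.mem_lowShape hL.mono

/-- A label occurs at most once in each row. -/
lemma eq_of_row (hk : 1 ≤ k) (hL : IsResLabeling k n γ L) {r a b : ℕ} (ha : (r, a) ∈ γ)
    (hb : (r, b) ∈ γ) (h : L (r, a) = L (r, b)) : a = b := by
  have aux : ∀ a b, (r, a) ∈ γ → (r, b) ∈ γ → L (r, a) = L (r, b) → ¬ a < b := by
    intro a b _ hb h hlt
    have hm : (r, a + 1) ∈ γ := γ.up_left_mem le_rfl hlt hb
    have h1 := hL.row r a hm
    have h2 := hL.mono (r, b) (r, a + 1) (Prod.mk_le_mk.2 ⟨le_rfl, hlt⟩) hb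
    exact residue_right_ne hk r a
      (hL.res _ hm _ (γ.up_left_mem le_rfl hlt.le hb) (by omega))
  have h1 := aux a b ha hb h
  have h2 := aux b a hb ha h.symm
  omega

theorem chain (hk : 1 ≤ k) (hL : IsResLabeling k n γ L) (hγ : IsCore (k + 1) γ)
    (hn : pSize k γ = n) :
    (∀ y ≤ n, IsCore (k + 1) (lowShape γ L y) ∧ pSize k (lowShape γ L y) = y) ∧
    (∀ y < n, (∃ c ∈ γ, L c = y + 1) ∧ ∃ i : ZMod (k + 1), ∀ c,
      (c ∈ γ ∧ L c = y + 1) ↔ Removable (lowShape γ L (y + 1)) c ∧ residue k c = i) ∧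
    ∀ r x y, x ≤ y → y ≤ n → pRow k (lowShape γ L x) r ≤ pRow k (lowShape γ L y) r := by
  set i : ℕ → ZMod (k + 1) := fun y =>
    if h : ∃ c ∈ γ, L c = y + 1 then residue k h.choose else 0 with hi
  have hires : ∀ y, ∀ c ∈ γ, L c = y + 1 → residue k c = i y := by
    intro y c hc hy
    have h : ∃ c ∈ γ, L c = y + 1 := ⟨c, hc, hy⟩
    rw [hi]
    simp only [dif_pos h]
    exact hL.res _ hc _ h.choose_spec.1 (hy.trans h.choose_spec.2.symm)
  have h0 : lowShape γ L 0 = ⊥ := by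
    refine le_bot_iff.1 fun c hc => ?_
    have h1 := hL.mem_lowShape.1 hc
    have h2 := hL.pos c h1.1
    omega
  obtain ⟨-, e2, e3⟩ := chain_eq_removeCorners hk (i := i) h0 n γ hγ hn.ge
    (fun c hc => hL.mem_lowShape.2 ⟨hc, hL.le c hc⟩) fun y _ =>
    ⟨fun c hc => by
      have := hL.mem_lowShape.1 hc
      exact hL.mem_lowShape.2 ⟨this.1, by omega⟩, fun c hc hc' => by
      have := hL.mem_lowShape.1 hc
      rw [hL.mem_lowShape] at hc'
      refine hires y c this.1 ?_
      by_contra hcon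
      exact hc' ⟨this.1, by omega⟩⟩
  refine ⟨e2, fun y hy => ?_, fun r x y hxy => ?_⟩
  · obtain ⟨h1, c, hc, hci⟩ := e3 y hy
    have key : ∀ c, (c ∈ γ ∧ L c = y + 1) ↔
        Removable (lowShape γ L (y + 1)) c ∧ residue k c = i y := by
      intro c
      have h2 := mem_removeCorners (γ := lowShape γ L (y + 1)) (i := i y) (c := c)
      rw [← h1] at h2
      rw [hL.mem_lowShape, hL.mem_lowShape] at h2
      constructor
      · rintro ⟨hc, hcy⟩
        by_contra hcon
        have := (h2.2 ⟨⟨hc, by omega⟩, hcon⟩).2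
        omega
      · intro h
        have h3 := hL.mem_lowShape.1 h.1.1
        refine ⟨h3.1, ?_⟩
        by_contra hcon
        exact (h2.1 ⟨h3.1, by omega⟩).2 h
    exact ⟨⟨c, (key c).2 ⟨hc, hci⟩⟩, i y, key⟩
  · induction y, hxy using Nat.le_induction with
    | base => exact fun _ => le_rfl
    | succ y _ ih =>
      intro hy
      obtain ⟨h1, c, hc, hci⟩ := e3 y (by omega)
      refine (ih (by omega)).trans ?_
      rw [h1]
      exact (e2 (y + 1) hy).1.pRow_removeCorners_le hk hc hci r

end IsResLabeling

/-- The set-valued filling with the single letter `L c` in each cell. -/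
def singleFilling (γ : YoungDiagram) (L : ℕ × ℕ → ℕ) (c : ℕ × ℕ) : Finset ℕ :=
  if c ∈ γ then {L c} else ∅

lemma mem_singleFilling {γ : YoungDiagram} {L : ℕ × ℕ → ℕ} {c : ℕ × ℕ} {y : ℕ} :
    y ∈ singleFilling γ L c ↔ c ∈ γ ∧ L c = y := by
  unfold singleFilling
  split_ifs with h <;> simp [h, eq_comm]

lemma IsResLabeling.isStdASVT {k n : ℕ} (hk : 1 ≤ k) {γ : YoungDiagram} {L : ℕ × ℕ → ℕ}
    (hL : IsResLabeling k n γ L) (hγ : IsCore (k + 1) γ) (hn : pSize k γ = n) :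
    IsStdASVT k n γ (singleFilling γ L) := by
  obtain ⟨h1, h2, -⟩ := hL.chain hk hγ hn
  refine ⟨⟨fun c => ?_, fun c x hx => ?_, fun r c x hx y hy => ?_, fun r c x hx y hy => ?_⟩,
    fun c y hy => ?_, fun x hx hxn => ?_⟩
  · unfold singleFilling
    split_ifs with h <;> simp [h]
  · rw [mem_singleFilling] at hx
    rw [← hx.2]
    exact hL.pos c hx.1
  · rw [mem_singleFilling] at hx hy
    rw [← hx.2, ← hy.2]
    refine lt_of_le_of_ne (hL.col r c hy.1) fun h => ?_
    exact residue_above_ne hk r c (hL.res _ hy.1 _ hx.1 h.symm)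
  · rw [mem_singleFilling] at hx hy
    rw [← hx.2, ← hy.2]
    exact hL.row r c hy.1
  · rw [mem_singleFilling] at hy
    rw [← hy.2]
    exact hL.le c hy.1
  · obtain ⟨y, rfl⟩ : ∃ y, x = y + 1 := ⟨x - 1, by omega⟩
    obtain ⟨⟨c, hc, hcy⟩, i, hi⟩ := h2 y hxn
    refine ⟨lowShape γ L (y + 1), (h1 _ hxn).1, ?_, i, ⟨c, mem_singleFilling.2 ⟨hc, hcy⟩⟩,
      fun c => ?_⟩
    · ext c
      rw [YoungDiagram.mem_cells, hL.mem_lowShape]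
      simp [shapeLe, mem_singleFilling]
    · rw [mem_singleFilling, hi]

lemma IsStdASVT.exists_labeling {k n : ℕ} (hk : 1 ≤ k) {γ : YoungDiagram}
    {e : ℕ × ℕ → Finset ℕ} (he : IsStdASVT k n γ e) (hγ : IsCore (k + 1) γ)
    (hn : pSize k γ = n) : ∃ L, IsResLabeling k n γ L ∧ e = singleFilling γ L := by
  obtain ⟨⟨f1, f2, f3, f4⟩, f5, f6⟩ := he
  set L : ℕ × ℕ → ℕ := fun c => sInf (e c : Set ℕ) with hLdef
  have hmem : ∀ c ∈ γ, L c ∈ e c := fun c hc => by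
    have := Nat.sInf_mem (s := (e c : Set ℕ)) ((f1 c).1 hc)
    exact_mod_cast this
  have hle : ∀ c, ∀ y ∈ e c, L c ≤ y := fun c y hy => Nat.sInf_le (by exact_mod_cast hy)
  have hmemγ : ∀ c y, y ∈ e c → c ∈ γ := fun c y hy => (f1 c).2 ⟨y, hy⟩
  have hL : IsResLabeling k n γ L := by
    refine ⟨fun c hc => ?_, fun c hc => f2 c _ (hmem c hc), fun c hc => f5 c _ (hmem c hc),
      fun r c hc => ?_, fun r c hc => ?_, fun c hc d hd h => ?_⟩
    · rw [f1, Finset.not_nonempty_iff_eq_empty] at hc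
      simp [hLdef, hc]
    · exact f4 r c _ (hmem _ (γ.up_left_mem le_rfl (Nat.le_succ c) hc)) _ (hmem _ hc)
    · exact (f3 r c _ (hmem _ (γ.up_left_mem (Nat.le_succ r) le_rfl hc)) _ (hmem _ hc)).le
    · obtain ⟨δ, -, -, i, -, hi⟩ := f6 (L c) (f2 c _ (hmem c hc)) (f5 c _ (hmem c hc))
      rw [((hi c).1 (hmem c hc)).2, ((hi d).1 (h ▸ hmem d hd)).2]
  refine ⟨L, hL, ?_⟩
  obtain ⟨-, h2, -⟩ := hL.chain hk hγ hn
  funext c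
  ext y
  rw [mem_singleFilling]
  refine ⟨fun hy => ?_, fun h => h.2 ▸ hmem c h.1⟩
  have hy1 := f2 c y hy
  have hyn := f5 c y hy
  obtain ⟨δ, -, hδ, i, -, hi⟩ := f6 y hy1 hyn
  obtain ⟨z, rfl⟩ : ∃ z, y = z + 1 := ⟨y - 1, by omega⟩
  obtain ⟨⟨d, hd, hdz⟩, j, hj⟩ := h2 z hyn
  have hδ' : δ = lowShape γ L (z + 1) := by
    ext c
    rw [hδ, YoungDiagram.mem_cells, hL.mem_lowShape]
    simp only [shapeLe, Finset.mem_filter, YoungDiagram.mem_cells]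
    exact ⟨fun ⟨h1, y, h2, h3⟩ => ⟨h1, (hle c y h2).trans h3⟩,
      fun ⟨h1, h2⟩ => ⟨h1, L c, hmem c h1, h2⟩⟩
  have hij : i = j := by
    rw [← ((hj d).1 ⟨hd, hdz⟩).2, ← ((hi d).1 (hdz ▸ hmem d hd)).2]
  rw [hj, ← hij, ← hδ']
  exact (hi c).1 hy

/-! ## Labelings attached to a `k`-tableau -/

/-- Partial sums of a composition. -/
def partialSum (α : List ℕ) (x : ℕ) : ℕ := (α.take x).sum

lemma partialSum_succ (α : List ℕ) (x : ℕ) :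
    partialSum α (x + 1) = partialSum α x + α.getD x 0 := by
  unfold partialSum
  rw [List.take_add_one, List.sum_append, List.getD_eq_getElem?_getD]
  cases α[x]? <;> simp

lemma partialSum_mono (α : List ℕ) : Monotone (partialSum α) :=
  monotone_nat_of_le_succ fun x => by rw [partialSum_succ]; omega

lemma partialSum_length (α : List ℕ) : partialSum α α.length = α.sum := by
  simp [partialSum]

lemma mem_alphaBlock {α : List ℕ} {x y : ℕ} :
    y ∈ alphaBlock α x ↔ partialSum α (x - 1) < y ∧ y ≤ partialSum α x := by
  simp [alphaBlock, partialSum]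

/-- The index of the block of `α` containing the letter `y`. -/
noncomputable def blockIndex (α : List ℕ) (y : ℕ) : ℕ := sInf {x | y ≤ partialSum α x}

lemma blockIndex_eq {α : List ℕ} {x y : ℕ} (h : y ∈ alphaBlock α x) : blockIndex α y = x := by
  rw [mem_alphaBlock] at h
  refine le_antisymm (Nat.sInf_le h.2) ?_
  by_contra hcon
  have h1 : y ≤ partialSum α (blockIndex α y) :=
    Nat.sInf_mem (s := {x | y ≤ partialSum α x}) ⟨x, h.2⟩
  have h2 := partialSum_mono α (show blockIndex α y ≤ x - 1 by omega)
  omega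

lemma blockIndex_zero (α : List ℕ) : blockIndex α 0 = 0 := by
  have : blockIndex α 0 ≤ 0 := Nat.sInf_le (Nat.zero_le _)
  omega

lemma mem_alphaBlock_blockIndex {α : List ℕ} {y : ℕ} (h1 : 1 ≤ y) (h2 : y ≤ α.sum) :
    y ∈ alphaBlock α (blockIndex α y) ∧ 1 ≤ blockIndex α y ∧ blockIndex α y ≤ α.length := by
  have h3 : y ≤ partialSum α (blockIndex α y) :=
    Nat.sInf_mem (s := {x | y ≤ partialSum α x}) ⟨α.length, by simpa [partialSum_length] using h2⟩
  have h4 : 1 ≤ blockIndex α y := by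
    by_contra hcon
    rw [show blockIndex α y = 0 by omega] at h3
    simp [partialSum] at h3
    omega
  refine ⟨mem_alphaBlock.2 ⟨?_, h3⟩, h4, Nat.sInf_le (by simpa [partialSum_length] using h2)⟩
  by_contra hcon
  have : blockIndex α y ≤ blockIndex α y - 1 := Nat.sInf_le (by simpa using hcon)
  omega

/-- The residues of the cells of `γ` with letter `x`. -/
noncomputable def stripRes (k : ℕ) (γ : YoungDiagram) (u : ℕ × ℕ → ℕ) (x : ℕ) :
    Finset (ZMod (k + 1)) :=
  (γ.cells.filter fun c => u c = x).image (residue k)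

lemma mem_stripRes {k : ℕ} {γ : YoungDiagram} {u : ℕ × ℕ → ℕ} {x : ℕ} {ρ : ZMod (k + 1)} :
    ρ ∈ stripRes k γ u x ↔ ∃ c ∈ γ, u c = x ∧ residue k c = ρ := by
  simp only [stripRes, Finset.mem_image, Finset.mem_filter, YoungDiagram.mem_cells, and_assoc]

/-- The labels obtained by listing the residues of each strip in the order prescribed by `key`. -/
noncomputable def rankLabel (k : ℕ) (α : List ℕ) (γ : YoungDiagram) (u : ℕ × ℕ → ℕ)
    (key : ℕ → ZMod (k + 1) → ℕ) (c : ℕ × ℕ) : ℕ :=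
  if c ∈ γ then partialSum α (u c - 1) +
    ((stripRes k γ u (u c)).filter fun ρ => key (u c) ρ ≤ key (u c) (residue k c)).card
  else 0

/-- The key is injective on the residues of each strip, and increases along adjacent cells of a
strip. -/
structure IsStripKey (k : ℕ) (γ : YoungDiagram) (u : ℕ × ℕ → ℕ)
    (key : ℕ → ZMod (k + 1) → ℕ) : Prop where
  inj : ∀ x, ∀ ρ ∈ stripRes k γ u x, ∀ σ ∈ stripRes k γ u x, key x ρ = key x σ → ρ = σ
  step : ∀ r c, (r, c + 1) ∈ γ → u (r, c) = u (r, c + 1) →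
    key (u (r, c)) (residue k (r, c)) ≤ key (u (r, c)) (residue k (r, c + 1))

namespace IsKTab

variable {k : ℕ} {α : List ℕ} {γ : YoungDiagram} {u : ℕ × ℕ → ℕ}

lemma pos (hu : IsKTab k α γ u) {c : ℕ × ℕ} (hc : c ∈ γ) : 1 ≤ u c :=
  Nat.one_le_iff_ne_zero.2 ((hu.1 c).1 hc)

lemma row (hu : IsKTab k α γ u) (r c : ℕ) (h : (r, c + 1) ∈ γ) : u (r, c) ≤ u (r, c + 1) :=
  hu.2.2.2.1 r c (γ.up_left_mem le_rfl (Nat.le_succ c) h) h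

lemma col (hu : IsKTab k α γ u) (r c : ℕ) (h : (r + 1, c) ∈ γ) : u (r, c) < u (r + 1, c) :=
  hu.2.2.1 r c (γ.up_left_mem (Nat.le_succ r) le_rfl h) h

lemma mono (hu : IsKTab k α γ u) (c d : ℕ × ℕ) (hd : d ≤ c) (hc : c ∈ γ) : u d ≤ u c :=
  label_mono hu.row (fun r c h => (hu.col r c h).le) hd hc

lemma card_stripRes (hu : IsKTab k α γ u) {x : ℕ} (h1 : 1 ≤ x) (h2 : x ≤ α.length) :
    (stripRes k γ u x).card = α.getD (x - 1) 0 := by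
  rw [← hu.2.2.2.2 x h1 h2]
  rfl

/-- The cells with a given letter form a horizontal strip. -/
lemma lt_of_lt (hu : IsKTab k α γ u) {a b : ℕ × ℕ} (hb : b ∈ γ) (hab : u a = u b)
    (h : a.1 < b.1) : b.2 < a.2 := by
  by_contra hcon
  obtain ⟨b1, b2⟩ := b
  obtain ⟨m, rfl⟩ : ∃ m, b1 = m + 1 := ⟨b1 - 1, by simp only at h; omega⟩
  have h1 := hu.col m b2 hb
  have h2 := hu.mono (m, b2) a (Prod.le_def.2 ⟨by simp only at h ⊢; omega, by simpa using hcon⟩)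
    (γ.up_left_mem (Nat.le_succ m) le_rfl hb)
  omega

lemma rankLabel_mem (hu : IsKTab k α γ u) (key : ℕ → ZMod (k + 1) → ℕ) {c : ℕ × ℕ}
    (hc : c ∈ γ) : rankLabel k α γ u key c ∈ alphaBlock α (u c) := by
  rw [mem_alphaBlock]
  unfold rankLabel
  rw [if_pos hc]
  have h1 := hu.pos hc
  have h2 := hu.card_stripRes h1 (hu.2.1 c)
  have h3 := partialSum_succ α (u c - 1)
  rw [Nat.sub_add_cancel h1] at h3
  have h4 := Finset.card_le_card (Finset.filter_subset
    (fun ρ => key (u c) ρ ≤ key (u c) (residue k c)) (stripRes k γ u (u c)))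
  have h5 : 0 < ((stripRes k γ u (u c)).filter
      fun ρ => key (u c) ρ ≤ key (u c) (residue k c)).card :=
    Finset.card_pos.2 ⟨residue k c, Finset.mem_filter.2 ⟨mem_stripRes.2 ⟨c, hc, rfl, rfl⟩, le_rfl⟩⟩
  omega

lemma blockIndex_rankLabel (hu : IsKTab k α γ u) (key : ℕ → ZMod (k + 1) → ℕ) {c : ℕ × ℕ}
    (hc : c ∈ γ) : blockIndex α (rankLabel k α γ u key c) = u c :=
  blockIndex_eq (hu.rankLabel_mem key hc)

lemma rankLabel_le_partialSum (hu : IsKTab k α γ u) (key : ℕ → ZMod (k + 1) → ℕ) {c : ℕ × ℕ}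
    (hc : c ∈ γ) (x : ℕ) : rankLabel k α γ u key c ≤ partialSum α x ↔ u c ≤ x := by
  have h := mem_alphaBlock.1 (hu.rankLabel_mem key hc)
  constructor
  · intro h1
    by_contra hcon
    have := partialSum_mono α (show x ≤ u c - 1 by omega)
    omega
  · intro h1
    exact h.2.trans (partialSum_mono α h1)

lemma rankLabel_le_iff (_hu : IsKTab k α γ u) (key : ℕ → ZMod (k + 1) → ℕ) {c d : ℕ × ℕ}
    (hc : c ∈ γ) (hd : d ∈ γ) (hcd : u c = u d) :
    rankLabel k α γ u key c ≤ rankLabel k α γ u key d ↔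
      key (u c) (residue k c) ≤ key (u c) (residue k d) := by
  unfold rankLabel
  rw [if_pos hc, if_pos hd, ← hcd, Nat.add_le_add_iff_left]
  constructor
  · intro h
    by_contra hcon
    refine absurd h (not_le.2 (Finset.card_lt_card ?_))
    rw [Finset.ssubset_iff_of_subset]
    · exact ⟨residue k c, Finset.mem_filter.2 ⟨mem_stripRes.2 ⟨c, hc, rfl, rfl⟩, le_rfl⟩,
        fun h => hcon (Finset.mem_filter.1 h).2⟩
    · intro ρ hρ
      rw [Finset.mem_filter] at hρ ⊢
      exact ⟨hρ.1, by omega⟩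
  · intro h
    refine Finset.card_le_card fun ρ hρ => ?_
    rw [Finset.mem_filter] at hρ ⊢
    exact ⟨hρ.1, hρ.2.trans h⟩

lemma isResLabeling (hu : IsKTab k α γ u) {key : ℕ → ZMod (k + 1) → ℕ}
    (hkey : IsStripKey k γ u key) : IsResLabeling k α.sum γ (rankLabel k α γ u key) := by
  have hlt : ∀ c d, c ∈ γ → d ∈ γ → u c < u d →
      rankLabel k α γ u key c ≤ rankLabel k α γ u key d := by
    intro c d hc hd h
    have h1 := (hu.rankLabel_le_partialSum key hc (u d - 1)).2 (by omega)
    have h2 := (mem_alphaBlock.1 (hu.rankLabel_mem key hd)).1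
    omega
  refine ⟨fun c hc => if_neg hc, fun c hc => ?_, fun c hc => ?_, fun r c h => ?_, fun r c h => ?_,
    fun c hc d hd h => ?_⟩
  · have := (mem_alphaBlock.1 (hu.rankLabel_mem key hc)).1
    omega
  · rw [← partialSum_length]
    exact (hu.rankLabel_le_partialSum key hc _).2 (hu.2.1 c)
  · have h' : (r, c) ∈ γ := γ.up_left_mem le_rfl (Nat.le_succ c) h
    rcases (hu.row r c h).lt_or_eq with hlt' | heq
    · exact hlt _ _ h' h hlt'
    · exact (hu.rankLabel_le_iff key h' h heq).2 (hkey.step r c h heq)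
  · exact hlt _ _ (γ.up_left_mem (Nat.le_succ r) le_rfl h) h (hu.col r c h)
  · have hcd : u c = u d := by
      rw [← hu.blockIndex_rankLabel key hc, h, hu.blockIndex_rankLabel key hd]
    have h1 := (hu.rankLabel_le_iff key hc hd hcd).1 h.le
    have h2 := (hu.rankLabel_le_iff key hd hc hcd.symm).1 h.ge
    rw [← hcd] at h2
    exact hkey.inj (u c) _ (mem_stripRes.2 ⟨c, hc, rfl, rfl⟩) _
      (mem_stripRes.2 ⟨d, hd, hcd.symm, rfl⟩) (le_antisymm h1 h2)

end IsKTab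

/-! ### Cyclic order -/

/-- A residue missing from the strip, if there is one. -/
noncomputable def missingRes (k : ℕ) (γ : YoungDiagram) (u : ℕ × ℕ → ℕ) (x : ℕ) : ZMod (k + 1) :=
  Classical.epsilon fun i => i ∉ stripRes k γ u x

/-- Order the residues of each strip cyclically, starting after a missing residue. -/
noncomputable def cyclicKey (k : ℕ) (γ : YoungDiagram) (u : ℕ × ℕ → ℕ) (x : ℕ)
    (ρ : ZMod (k + 1)) : ℕ :=
  (ρ - missingRes k γ u x).val

lemma IsKTab.missingRes_notMem {k : ℕ} {α : List ℕ} {γ : YoungDiagram} {u : ℕ × ℕ → ℕ}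
    (hu : IsKTab k α γ u) (hα : ∀ a ∈ α, a ≤ k) (x : ℕ) (hx : 1 ≤ x) (hx' : x ≤ α.length) :
    missingRes k γ u x ∉ stripRes k γ u x := by
  refine Classical.epsilon_spec (p := fun i => i ∉ stripRes k γ u x) ?_
  by_contra hcon
  push Not at hcon
  have h1 := hu.card_stripRes hx hx'
  rw [Finset.eq_univ_of_forall hcon, Finset.card_univ, ZMod.card,
    List.getD_eq_getElem α 0 (by omega : x - 1 < α.length)] at h1
  have := hα _ (List.getElem_mem (by omega : x - 1 < α.length))
  omega

lemma IsKTab.isStripKey_cyclicKey {k : ℕ} (hk : 1 ≤ k) {α : List ℕ} {γ : YoungDiagram}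
    {u : ℕ × ℕ → ℕ} (hu : IsKTab k α γ u) (hα : ∀ a ∈ α, a ≤ k) :
    IsStripKey k γ u (cyclicKey k γ u) := by
  refine ⟨fun x ρ _ σ _ h => ?_, fun r c h hx => ?_⟩
  · have := ZMod.val_injective (k + 1) h
    linear_combination this
  · have h1 := hu.missingRes_notMem hα _ (hu.pos h) (hu.2.1 _)
    rw [← hx] at h1
    unfold cyclicKey
    have e : residue k (r, c + 1) - missingRes k γ u (u (r, c)) =
        (residue k (r, c) - missingRes k γ u (u (r, c))) + 1 := by
      unfold residue
      push_cast
      ring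
    rw [e]
    set t := residue k (r, c) - missingRes k γ u (u (r, c)) with ht
    have hne : t + 1 ≠ 0 := by
      rw [← e]
      intro h0
      refine h1 (mem_stripRes.2 ⟨(r, c + 1), h, hx.symm, sub_eq_zero.1 h0⟩)
    have : Fact (1 < k + 1) := ⟨by omega⟩
    have hval : (t + 1).val = t.val + 1 := by
      rw [ZMod.val_add_of_lt, ZMod.val_one]
      rw [ZMod.val_one]
      have h2 := ZMod.val_lt t
      by_contra hcon
      apply hne
      have h3 : t.val + 1 = k + 1 := by omega
      have h4 : ((t.val + 1 : ℕ) : ZMod (k + 1)) = 0 := by rw [h3, ZMod.natCast_self]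
      rwa [Nat.cast_add, ZMod.natCast_zmod_val, Nat.cast_one] at h4
    omega

/-- The shape of the letters at most `x` in a `k`-tableau is a core of size `Σ^x α`. -/
theorem IsKTab.lowShape_core {k : ℕ} (hk : 1 ≤ k) {α : List ℕ} {γ : YoungDiagram}
    {u : ℕ × ℕ → ℕ} (hu : IsKTab k α γ u) (hα : ∀ a ∈ α, a ≤ k) (hγ : IsCore (k + 1) γ)
    (hn : pSize k γ = α.sum) (x : ℕ) :
    IsCore (k + 1) (lowShape γ u x) ∧ pSize k (lowShape γ u x) = partialSum α x ∧
      ∀ r, pRow k (lowShape γ u x) r ≤ pRow k γ r := by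
  have hL := hu.isResLabeling (hu.isStripKey_cyclicKey hk hα)
  obtain ⟨h1, -, h3⟩ := hL.chain hk hγ hn
  have e : ∀ x, lowShape γ u x =
      lowShape γ (rankLabel k α γ u (cyclicKey k γ u)) (partialSum α x) := by
    intro x
    ext c
    rw [YoungDiagram.mem_cells, YoungDiagram.mem_cells, mem_lowShape hu.mono, hL.mem_lowShape]
    exact and_congr_right fun hc => (hu.rankLabel_le_partialSum _ hc x).symm
  have hle : partialSum α x ≤ α.sum := by
    unfold partialSum
    exact (List.take_sublist x α).sum_le_sum fun _ _ => Nat.zero_le _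
  have hγ' : lowShape γ u α.length = γ := by
    ext c
    rw [YoungDiagram.mem_cells, YoungDiagram.mem_cells, mem_lowShape hu.mono]
    exact ⟨fun h => h.1, fun h => ⟨h, hu.2.1 c⟩⟩
  rw [e x]
  refine ⟨(h1 _ hle).1, (h1 _ hle).2, fun r => ?_⟩
  have := h3 r _ _ hle le_rfl
  rwa [← partialSum_length, ← e, ← e, hγ', e] at this

/-! ### Ordering by lowest occurrences -/

/-- The last column containing a cell with letter `x` and residue `ρ`. -/
noncomputable def columnKey (k : ℕ) (γ : YoungDiagram) (u : ℕ × ℕ → ℕ) (x : ℕ)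
    (ρ : ZMod (k + 1)) : ℕ :=
  (γ.cells.filter fun c => u c = x ∧ residue k c = ρ).sup Prod.snd

lemma le_columnKey {k : ℕ} {γ : YoungDiagram} {u : ℕ × ℕ → ℕ} {c : ℕ × ℕ} (hc : c ∈ γ) :
    c.2 ≤ columnKey k γ u (u c) (residue k c) :=
  Finset.le_sup (f := Prod.snd) (by simp [hc])

lemma exists_columnKey {k : ℕ} {γ : YoungDiagram} {u : ℕ × ℕ → ℕ} {x : ℕ} {ρ : ZMod (k + 1)}
    (h : ρ ∈ stripRes k γ u x) :
    ∃ c ∈ γ, u c = x ∧ residue k c = ρ ∧ c.2 = columnKey k γ u x ρ := by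
  obtain ⟨c, hc, hx, hρ⟩ := mem_stripRes.1 h
  obtain ⟨d, hd, hd'⟩ := Finset.exists_mem_eq_sup
    (γ.cells.filter fun c => u c = x ∧ residue k c = ρ) ⟨c, by simp [hc, hx, hρ]⟩ Prod.snd
  simp only [Finset.mem_filter, YoungDiagram.mem_cells] at hd
  exact ⟨d, hd.1, hd.2.1, hd.2.2, hd'.symm⟩

theorem IsKTab.isStripKey_columnKey {k : ℕ} (hk : 1 ≤ k) {α : List ℕ} {γ : YoungDiagram}
    {u : ℕ × ℕ → ℕ} (hu : IsKTab k α γ u) (hα : ∀ a ∈ α, a ≤ k) (hγ : IsCore (k + 1) γ)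
    (hn : pSize k γ = α.sum) : IsStripKey k γ u (columnKey k γ u) := by
  refine ⟨fun x ρ hρ σ hσ h => ?_, fun r c h hx => ?_⟩
  · obtain ⟨a, ha, hax, haρ, ha2⟩ := exists_columnKey hρ
    obtain ⟨b, hb, hbx, hbσ, hb2⟩ := exists_columnKey hσ
    have h2 : a.2 = b.2 := by omega
    have h1 : a.1 = b.1 := by
      rcases Nat.lt_trichotomy a.1 b.1 with h' | h' | h'
      · have := hu.lt_of_lt hb (hax.trans hbx.symm) h'
        omega
      · exact h'
      · have := hu.lt_of_lt ha (hbx.trans hax.symm) h'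
        omega
    rw [← haρ, ← hbσ, Prod.ext h1 h2]
  · have h' : (r, c) ∈ γ := γ.up_left_mem le_rfl (Nat.le_succ c) h
    obtain ⟨⟨a, b⟩, hd, hdx, hdρ, hd2⟩ :=
      exists_columnKey (mem_stripRes.2 ⟨(r, c), h', rfl, rfl⟩ :
        residue k (r, c) ∈ stripRes k γ u (u (r, c)))
    rw [← hd2]
    have hres1 : residue k (r, c + 1) = residue k (r, c) + 1 := by
      unfold residue
      push_cast
      ring
    by_cases hright : (a, b + 1) ∈ γ ∧ u (a, b + 1) = u (r, c)
    · have h1 := le_columnKey (k := k) (u := u) hright.1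
      have h2 : residue k (a, b + 1) = residue k (r, c + 1) := by
        rw [hres1, ← hdρ]
        unfold residue
        push_cast
        ring
      rw [hright.2, h2] at h1
      simp only at h1 ⊢
      omega
    · have hkey := hu.isStripKey_cyclicKey hk hα
      have hL := hu.isResLabeling hkey
      set L := rankLabel k α γ u (cyclicKey k γ u) with hLdef
      obtain ⟨hcore, hcorner, -⟩ := hL.chain hk hγ hn
      obtain ⟨y, hy⟩ : ∃ y, L (r, c + 1) = y + 1 := ⟨L (r, c + 1) - 1, by
        have := hL.pos _ h
        omega⟩
      have hyn := hL.le _ h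
      rw [hy] at hyn
      obtain ⟨-, i, hi⟩ := hcorner y hyn
      have hrem := ((hi _).1 ⟨h, hy⟩).1
      have hcoreδ := (hcore _ hyn).1
      set δ := lowShape γ L (y + 1) with hδ
      have hdδ : (a, b) ∈ δ := by
        rw [hL.mem_lowShape]
        refine ⟨hd, ?_⟩
        rw [← hy, hu.rankLabel_le_iff _ hd h (hdx.trans hx), hdx, hdρ]
        exact hkey.step r c h hx
      have hdδ' : (a, b + 1) ∉ δ := by
        rw [hL.mem_lowShape]
        rintro ⟨h1, h2⟩
        have h3 : L (a, b + 1) ≤ partialSum α (u (r, c)) := by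
          refine h2.trans (hy ▸ ?_)
          rw [hx]
          exact (mem_alphaBlock.1 (hu.rankLabel_mem _ h)).2
        rw [hu.rankLabel_le_partialSum _ h1] at h3
        have h4 := hu.row a b h1
        exact hright ⟨h1, by omega⟩
      rw [YoungDiagram.mem_iff_lt_rowLen] at hdδ hdδ'
      have hbead : beadPos δ a = (b : ℤ) - a := by
        unfold beadPos
        omega
      rw [removable_iff] at hrem
      have hbead' : beadPos δ r = ((c : ℤ) + 1) - r := by
        unfold beadPos
        omega
      have hlt : (b : ℤ) - a < c - r := by
        by_contra hcon
        refine hrem.2 (hcoreδ.isBead_of_le ⟨a, hbead⟩ (by omega) ?_)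
        rw [hbead']
        unfold residue at hdρ
        push_cast
        linear_combination -hdρ
      have hcol := le_columnKey (k := k) (u := u) h
      rw [← hx] at hcol
      simp only at hcol ⊢
      refine le_trans ?_ hcol
      by_contra hcon
      have := hu.lt_of_lt hd (hx.symm.trans hdx.symm) (show (r, c + 1).1 < (a, b).1 by
        simp only
        omega)
      simp only at this
      omega

/-! ## Affine set-valued tableaux of top degree are `k`-tableaux -/

lemma blockIndex_mono {α : List ℕ} {y z : ℕ} (h : y ≤ z) (hz : z ≤ α.sum) :
    blockIndex α y ≤ blockIndex α z :=
  Nat.sInf_le (h.trans (Nat.sInf_mem (s := {x | z ≤ partialSum α x})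
    ⟨α.length, by simpa [partialSum_length] using hz⟩))

lemma exists_isLowestOcc {e : ℕ × ℕ → Finset ℕ} {y : ℕ} (h : ∃ c, y ∈ e c) :
    ∃ c, IsLowestOcc e y c := by
  have hex : ∃ r c, y ∈ e (r, c) := by
    obtain ⟨⟨r, c⟩, hc⟩ := h
    exact ⟨r, c, hc⟩
  obtain ⟨c, hc⟩ := Nat.find_spec hex
  exact ⟨(Nat.find hex, c), hc, fun d hd => Nat.find_min' hex ⟨d.2, hd⟩⟩

section

variable {k : ℕ} {α : List ℕ} {γ : YoungDiagram} {L u : ℕ × ℕ → ℕ}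

lemma IsKTab.isLowestOcc_snd (hk : 1 ≤ k) (hu : IsKTab k α γ u)
    (hL : IsResLabeling k α.sum γ L)
    (hblk : ∀ c ∈ γ, ∀ d ∈ γ, u c = u d → residue k c = residue k d → L c = L d)
    {y : ℕ} {c : ℕ × ℕ} (hc : IsLowestOcc (singleFilling γ L) y c) :
    c ∈ γ ∧ L c = y ∧ c.2 = columnKey k γ u (u c) (residue k c) := by
  obtain ⟨h1, h2⟩ := hc
  rw [mem_singleFilling] at h1
  obtain ⟨h1, h3⟩ := h1
  refine ⟨h1, h3, le_antisymm (le_columnKey h1) ?_⟩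
  obtain ⟨d, hd, hdu, hdρ, hd2⟩ :=
    exists_columnKey (mem_stripRes.2 ⟨c, h1, rfl, rfl⟩ : residue k c ∈ stripRes k γ u (u c))
  rw [← hd2]
  have hLd := hblk d hd c h1 hdu hdρ
  have h4 := h2 d (mem_singleFilling.2 ⟨hd, hLd.trans h3⟩)
  rcases h4.lt_or_eq with hlt | heq
  · exact (hu.lt_of_lt hd hdu.symm hlt).le
  · obtain ⟨r, a⟩ := c
    obtain ⟨r', b⟩ := d
    simp only at heq
    subst heq
    exact (hL.eq_of_row hk hd h1 hLd).le

lemma exists_mem_singleFilling_iff (hL : IsResLabeling k α.sum γ L)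
    (hLu : ∀ c ∈ γ, blockIndex α (L c) = u c) (x : ℕ) (c : ℕ × ℕ) :
    (∃ y ∈ alphaBlock α x, y ∈ singleFilling γ L c) ↔ c ∈ γ ∧ u c = x := by
  constructor
  · rintro ⟨y, hy, hyc⟩
    obtain ⟨hc, rfl⟩ := mem_singleFilling.1 hyc
    exact ⟨hc, by rw [← hLu c hc, blockIndex_eq hy]⟩
  · rintro ⟨hc, rfl⟩
    refine ⟨L c, ?_, mem_singleFilling.2 ⟨hc, rfl⟩⟩
    rw [← hLu c hc]
    exact (mem_alphaBlock_blockIndex (hL.pos c hc) (hL.le c hc)).1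

theorem IsKTab.isASVT (hk : 1 ≤ k) (hα : ∀ a ∈ α, a ≤ k) (hγ : IsCore (k + 1) γ)
    (hn : pSize k γ = α.sum) (hu : IsKTab k α γ u) :
    IsASVT k α γ (singleFilling γ (rankLabel k α γ u (columnKey k γ u))) := by
  have hkey := hu.isStripKey_columnKey hk hα hγ hn
  have hL := hu.isResLabeling hkey
  set L := rankLabel k α γ u (columnKey k γ u) with hLdef
  have hLu : ∀ c ∈ γ, blockIndex α (L c) = u c := fun c hc => hu.blockIndex_rankLabel _ hc
  have hblk : ∀ c ∈ γ, ∀ d ∈ γ, u c = u d → residue k c = residue k d → L c = L d := by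
    intro c hc d hd h1 h2
    rw [hLdef]
    unfold rankLabel
    rw [if_pos hc, if_pos hd, h1, h2]
  refine ⟨hL.isStdASVT hk hγ hn, fun x hx hx' => ⟨?_, ?_, ?_⟩⟩
  · intro y z hy hz hyz cy cz hcy hcz
    obtain ⟨m1, l1, s1⟩ := hu.isLowestOcc_snd hk hL hblk hcy
    obtain ⟨m2, l2, s2⟩ := hu.isLowestOcc_snd hk hL hblk hcz
    have u1 : u cy = x := by rw [← hLu cy m1, l1, blockIndex_eq hy]
    have u2 : u cz = x := by rw [← hLu cz m2, l2, blockIndex_eq hz]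
    have hlt : cy.2 < cz.2 := by
      rw [s1, s2, u1, u2]
      by_contra hcon
      have h := (hu.rankLabel_le_iff (columnKey k γ u) m2 m1 (u2.trans u1.symm)).2
        (by rw [u2]; omega)
      rw [← hLdef] at h
      omega
    rcases Nat.lt_trichotomy cy.1 cz.1 with h | h | h
    · have := hu.lt_of_lt m2 (u1.trans u2.symm) h
      omega
    · exact Or.inr ⟨h, hlt⟩
    · exact Or.inl h
  · rw [← hu.2.2.2.2 x hx hx']
    congr 2
    ext c
    simp only [Finset.mem_filter, YoungDiagram.mem_cells, exists_mem_singleFilling_iff hL hLu]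
    tauto
  · intro c d hc hd hcd
    rw [exists_mem_singleFilling_iff hL hLu] at hc hd
    rcases Nat.lt_trichotomy c.1 d.1 with h | h | h
    · have := hu.lt_of_lt hd.1 (hc.2.trans hd.2.symm) h
      omega
    · exact Prod.ext h hcd
    · have := hu.lt_of_lt hc.1 (hd.2.trans hc.2.symm) h
      omega

lemma card_alphaBlock (α : List ℕ) {x : ℕ} (hx : 1 ≤ x) :
    (alphaBlock α x).card = α.getD (x - 1) 0 := by
  have h := partialSum_succ α (x - 1)
  rw [Nat.sub_add_cancel hx] at h
  have : alphaBlock α x = Finset.Ioc (partialSum α (x - 1)) (partialSum α x) := rfl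
  rw [this, Nat.card_Ioc]
  omega

theorem IsASVT.exists_isKTab (hk : 1 ≤ k) (hγ : IsCore (k + 1) γ)
    (hn : pSize k γ = α.sum) {e : ℕ × ℕ → Finset ℕ} (he : IsASVT k α γ e) :
    ∃ u, IsKTab k α γ u ∧ singleFilling γ (rankLabel k α γ u (columnKey k γ u)) = e := by
  obtain ⟨hstd, he⟩ := he
  obtain ⟨L, hL, rfl⟩ := hstd.exists_labeling hk hγ hn
  set u : ℕ × ℕ → ℕ := fun c => blockIndex α (L c) with hudef
  have hLu : ∀ c ∈ γ, blockIndex α (L c) = u c := fun c _ => rfl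
  have hspec : ∀ c ∈ γ, L c ∈ alphaBlock α (u c) ∧ 1 ≤ u c ∧ u c ≤ α.length := fun c hc =>
    mem_alphaBlock_blockIndex (hL.pos c hc) (hL.le c hc)
  have hz : ∀ c, c ∉ γ → u c = 0 := fun c hc => by
    rw [hudef]
    simp only [hL.zero c hc, blockIndex_zero]
  have hu : IsKTab k α γ u := by
    refine ⟨fun c => ⟨fun hc => ?_, fun hc => ?_⟩, fun c => ?_, fun r c h h' => ?_,
      fun r c h h' => ?_, fun x hx hx' => ?_⟩
    · have := hspec c hc
      omega
    · by_contra hcon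
      exact hc (hz c hcon)
    · by_cases hc : c ∈ γ
      · exact (hspec c hc).2.2
      · rw [hz c hc]
        exact Nat.zero_le _
    · refine lt_of_le_of_ne (blockIndex_mono (hL.col r c h') (hL.le _ h')) fun heq => ?_
      have hs := hspec _ h'
      have := (he (u (r + 1, c)) hs.2.1 hs.2.2).2.2 (r, c) (r + 1, c)
        ((exists_mem_singleFilling_iff hL hLu _ _).2 ⟨h, heq⟩)
        ((exists_mem_singleFilling_iff hL hLu _ _).2 ⟨h', rfl⟩) rfl
      simp at this
    · exact blockIndex_mono (hL.row r c h') (hL.le _ h')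
    · rw [← (he x hx hx').2.1]
      congr 2
      ext c
      simp only [Finset.mem_filter, YoungDiagram.mem_cells, exists_mem_singleFilling_iff hL hLu]
      tauto
  refine ⟨u, hu, ?_⟩
  obtain ⟨-, hcorner, -⟩ := hL.chain hk hγ hn
  have hocc : ∀ x, 1 ≤ x → x ≤ α.length → ∀ y ∈ alphaBlock α x, ∃ c ∈ γ, L c = y := by
    intro x _ hx y hy
    rw [mem_alphaBlock] at hy
    have hle := partialSum_mono α hx
    rw [partialSum_length] at hle
    obtain ⟨z, rfl⟩ : ∃ z, y = z + 1 := ⟨y - 1, by omega⟩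
    exact (hcorner z (by omega)).1
  set f : ℕ → ZMod (k + 1) := fun y => if h : ∃ c ∈ γ, L c = y then residue k h.choose else 0
    with hf
  have hfres : ∀ c ∈ γ, residue k c = f (L c) := by
    intro c hc
    have h : ∃ d ∈ γ, L d = L c := ⟨c, hc, rfl⟩
    rw [hf]
    simp only [dif_pos h]
    exact hL.res _ hc _ h.choose_spec.1 h.choose_spec.2.symm
  have himage : ∀ x, 1 ≤ x → x ≤ α.length → (alphaBlock α x).image f = stripRes k γ u x := by
    intro x hx hx'
    ext ρ
    rw [Finset.mem_image, mem_stripRes]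
    constructor
    · rintro ⟨y, hy, rfl⟩
      obtain ⟨c, hc, rfl⟩ := hocc x hx hx' y hy
      exact ⟨c, hc, blockIndex_eq hy, hfres c hc⟩
    · rintro ⟨c, hc, rfl, rfl⟩
      exact ⟨L c, (hspec c hc).1, (hfres c hc).symm⟩
  have hinj : ∀ x, 1 ≤ x → x ≤ α.length → Set.InjOn f (alphaBlock α x) := by
    intro x hx hx'
    rw [← Finset.card_image_iff, himage x hx hx', hu.card_stripRes hx hx', card_alphaBlock α hx]
  have hblk : ∀ c ∈ γ, ∀ d ∈ γ, u c = u d → residue k c = residue k d → L c = L d := by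
    intro c hc d hd h1 h2
    have hs := hspec c hc
    refine hinj (u c) hs.2.1 hs.2.2 hs.1 ?_ ?_
    · rw [h1]
      exact (hspec d hd).1
    · rw [← hfres c hc, ← hfres d hd, h2]
  have hkeylt : ∀ x, 1 ≤ x → x ≤ α.length → ∀ y ∈ alphaBlock α x, ∀ z ∈ alphaBlock α x, y < z →
      columnKey k γ u x (f y) < columnKey k γ u x (f z) := by
    intro x hx hx' y hy z hz hyz
    obtain ⟨c, hc, hcy⟩ := hocc x hx hx' y hy
    obtain ⟨d, hd, hdz⟩ := hocc x hx hx' z hz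
    obtain ⟨cy, hly⟩ := exists_isLowestOcc (e := singleFilling γ L)
      ⟨c, mem_singleFilling.2 ⟨hc, hcy⟩⟩
    obtain ⟨cz, hlz⟩ := exists_isLowestOcc (e := singleFilling γ L)
      ⟨d, mem_singleFilling.2 ⟨hd, hdz⟩⟩
    obtain ⟨m1, l1, s1⟩ := hu.isLowestOcc_snd hk hL hblk hly
    obtain ⟨m2, l2, s2⟩ := hu.isLowestOcc_snd hk hL hblk hlz
    have u1 : u cy = x := by rw [← hLu cy m1, l1, blockIndex_eq hy]
    have u2 : u cz = x := by rw [← hLu cz m2, l2, blockIndex_eq hz]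
    rw [hfres cy m1, l1, u1] at s1
    rw [hfres cz m2, l2, u2] at s2
    rw [← s1, ← s2]
    rcases (he x hx hx').1 y z hy hz hyz cy cz hly hlz with h | h
    · exact hu.lt_of_lt m1 (u2.trans u1.symm) h
    · exact h.2
  have hrank : ∀ c ∈ γ, rankLabel k α γ u (columnKey k γ u) c = L c := by
    intro c hc
    obtain ⟨hs, hx, hx'⟩ := hspec c hc
    unfold rankLabel
    rw [if_pos hc, ← himage _ hx hx']
    have hset : ((alphaBlock α (u c)).image f).filter
        (fun ρ => columnKey k γ u (u c) ρ ≤ columnKey k γ u (u c) (residue k c)) =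
        (Finset.Ioc (partialSum α (u c - 1)) (L c)).image f := by
      ext ρ
      simp only [Finset.mem_filter, Finset.mem_image, hfres c hc]
      constructor
      · rintro ⟨⟨y, hy, rfl⟩, hle⟩
        refine ⟨y, Finset.mem_Ioc.2 ⟨(mem_alphaBlock.1 hy).1, ?_⟩, rfl⟩
        by_contra hcon
        have := hkeylt _ hx hx' _ hs _ hy (by omega)
        omega
      · rintro ⟨y, hy, rfl⟩
        rw [Finset.mem_Ioc] at hy
        have hyb : y ∈ alphaBlock α (u c) :=
          mem_alphaBlock.2 ⟨hy.1, hy.2.trans (mem_alphaBlock.1 hs).2⟩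
        refine ⟨⟨y, hyb, rfl⟩, ?_⟩
        rcases hy.2.lt_or_eq with hlt | heq
        · exact (hkeylt _ hx hx' _ hyb _ hs hlt).le
        · rw [heq]
    rw [hset, Finset.card_image_of_injOn, Nat.card_Ioc]
    · have := mem_alphaBlock.1 hs
      omega
    · refine (hinj _ hx hx').mono fun y hy => ?_
      rw [Finset.mem_coe, Finset.mem_Ioc] at hy
      exact mem_alphaBlock.2 ⟨hy.1, hy.2.trans (mem_alphaBlock.1 hs).2⟩
  funext c
  unfold singleFilling
  split_ifs with hc
  · rw [hrank c hc]
  · rfl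

theorem card_isASVT_eq_card_isKTab (hk : 1 ≤ k) (hα : ∀ a ∈ α, a ≤ k) (hγ : IsCore (k + 1) γ)
    (hn : pSize k γ = α.sum) :
    Nat.card {e : ℕ × ℕ → Finset ℕ // IsASVT k α γ e} =
      Nat.card {u : ℕ × ℕ → ℕ // IsKTab k α γ u} := by
  symm
  refine Nat.card_eq_of_bijective (fun u => ⟨singleFilling γ
    (rankLabel k α γ u.1 (columnKey k γ u.1)), u.2.isASVT hk hα hγ hn⟩) ⟨?_, ?_⟩
  · rintro ⟨u, hu⟩ ⟨v, hv⟩ h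
    simp only [Subtype.mk.injEq] at h ⊢
    funext c
    by_cases hc : c ∈ γ
    · have h1 : rankLabel k α γ u (columnKey k γ u) c ∈
          singleFilling γ (rankLabel k α γ v (columnKey k γ v)) c := by
        rw [← h]
        exact mem_singleFilling.2 ⟨hc, rfl⟩
      rw [← hu.blockIndex_rankLabel (columnKey k γ u) hc, ← (mem_singleFilling.1 h1).2,
        hv.blockIndex_rankLabel _ hc]
    · have h1 := mt (hu.1 c).2 hc
      have h2 := mt (hv.1 c).2 hc
      push Not at h1 h2
      rw [h1, h2]
  · rintro ⟨e, he⟩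
    obtain ⟨u, hu, rfl⟩ := he.exists_isKTab hk hγ hn
    exact ⟨⟨u, hu⟩, rfl⟩

end

/-! ## The bijection between cores and bounded partitions -/

/-- In the last row of a core all hook lengths are at most `k`. -/
lemma IsCore.pRow_last {k : ℕ} {γ : YoungDiagram} (h : IsCore (k + 1) γ) {r : ℕ}
    (hr : γ.rowLen (r + 1) = 0) : pRow k γ r = γ.rowLen r := by
  have hcol : ∀ c, (r, c) ∈ γ → γ.colLen c = r + 1 := by
    intro c hc
    have h1 := YoungDiagram.mem_iff_lt_colLen.1 hc
    by_contra hcon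
    have h2 : (r + 1, c) ∈ γ := YoungDiagram.mem_iff_lt_colLen.2 (by omega)
    rw [YoungDiagram.mem_iff_lt_rowLen] at h2
    omega
  have hhook : ∀ c, (r, c) ∈ γ → hookLen γ r c = γ.rowLen r - c := by
    intro c hc
    unfold hookLen
    rw [hcol c hc]
    omega
  have hle : γ.rowLen r ≤ k := by
    by_contra hcon
    have hm : (r, γ.rowLen r - (k + 1)) ∈ γ := YoungDiagram.mem_iff_lt_rowLen.2 (by omega)
    refine h _ hm ?_
    rw [hhook _ hm]
    omega
  rw [YoungDiagram.rowLen_eq_card]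
  unfold pRow YoungDiagram.row
  congr 1
  ext ⟨a, b⟩
  simp only [Finset.mem_filter, YoungDiagram.mem_cells]
  refine and_congr_right fun hm => and_iff_left_of_imp ?_
  rintro rfl
  rw [hhook b hm]
  omega

lemma IsCore.colLen_le {k : ℕ} {γ γ' : YoungDiagram} (h' : IsCore (k + 1) γ')
    (hp : ∀ r, pRow k γ r = pRow k γ' r) : γ'.colLen 0 ≤ γ.colLen 0 := by
  by_contra hcon
  obtain ⟨m, hm⟩ : ∃ m, γ'.colLen 0 = m + 1 := ⟨γ'.colLen 0 - 1, by omega⟩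
  have h1 := h'.pRow_last ((rowLen_eq_zero_iff γ' (m + 1)).2 hm.le)
  have h2 := hp m
  rw [pRow_eq_zero ((rowLen_eq_zero_iff γ m).2 (by omega))] at h2
  have h3 := (rowLen_eq_zero_iff γ' m).1 (by omega)
  omega

/-- The map `𝔭` is injective on cores. -/
theorem IsCore.eq_of_pRow_eq {k : ℕ} (hk : 1 ≤ k) : ∀ {γ γ' : YoungDiagram},
    IsCore (k + 1) γ → IsCore (k + 1) γ' → (∀ r, pRow k γ r = pRow k γ' r) → γ = γ' := by
  suffices H : ∀ n, ∀ γ γ' : YoungDiagram, pSize k γ = n → IsCore (k + 1) γ → IsCore (k + 1) γ' →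
      (∀ r, pRow k γ r = pRow k γ' r) → γ = γ' from fun {γ γ'} h h' hp => H _ γ γ' rfl h h' hp
  intro n
  induction n with
  | zero =>
    intro γ γ' hn h h' hp
    have hz : ∀ δ : YoungDiagram, IsCore (k + 1) δ → (∀ r, pRow k δ r = 0) → δ = ⊥ := by
      intro δ hδ hδ'
      have := (rowLen_eq_zero_iff δ 0).2 ((hδ.colLen_le (γ := ⊥) (fun r => by
        rw [hδ' r]
        simp [pRow])).trans (by simp [YoungDiagram.colLen_eq_card, YoungDiagram.col]))
      refine le_bot_iff.1 fun c hc => ?_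
      have h1 : (0, c.2) ∈ δ := δ.up_left_mem (Nat.zero_le c.1) le_rfl hc
      rw [YoungDiagram.mem_iff_lt_rowLen] at h1
      omega
    have h0 : ∀ r, pRow k γ r = 0 := by
      intro r
      have : pRow k γ r ≤ pSize k γ := Finset.card_le_card fun c => by
        simp only [Finset.mem_filter]
        tauto
      omega
    rw [hz γ h h0, hz γ' h' fun r => (hp r).symm.trans (h0 r)]
  | succ n ih =>
    intro γ γ' hn h h' hp
    have hcol : γ.colLen 0 = γ'.colLen 0 :=
      le_antisymm (h.colLen_le fun r => (hp r).symm) (h'.colLen_le hp)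
    have hpos : 0 < γ.colLen 0 := by
      by_contra hcon
      rw [pSize_eq_sum k ((rowLen_eq_zero_iff γ 0).2 (by omega))] at hn
      simp at hn
    obtain ⟨m, hm⟩ : ∃ m, γ.colLen 0 = m + 1 := ⟨γ.colLen 0 - 1, by omega⟩
    have hlast : ∀ δ : YoungDiagram, IsCore (k + 1) δ → δ.colLen 0 = m + 1 →
        Removable δ (m, pRow k δ m - 1) ∧ ∀ i, residue k (m, pRow k δ m - 1) = i →
          act hk δ i = removeCorners k δ i ∧ pSize k δ = pSize k (removeCorners k δ i) + 1 ∧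
          ∀ r, pRow k δ r = pRow k (removeCorners k δ i) r + if r = m then 1 else 0 := by
      intro δ hδ hδm
      have h0 := (rowLen_eq_zero_iff δ (m + 1)).2 hδm.le
      have h1 := mt (rowLen_eq_zero_iff δ m).1 (by omega)
      have hp := hδ.pRow_last h0
      have hrem : Removable δ (m, pRow k δ m - 1) := by
        refine ⟨?_, ?_, ?_⟩ <;> rw [YoungDiagram.mem_iff_lt_rowLen] <;> try dsimp only
        all_goals omega
      refine ⟨hrem, fun i hi => ⟨hδ.act_eq_removeCorners hk hrem hi,
        hδ.pSize_removeCorners hk hrem hi, ?_⟩⟩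
      obtain ⟨d, hd, -, hmax, hrow⟩ := hδ.exists_pRow_removeCorners hk hrem hi
      have hd1 := hmax _ hrem hi
      have hd2 : (d.1, 0) ∈ δ := δ.up_left_mem le_rfl (Nat.zero_le _) hd.1
      rw [YoungDiagram.mem_iff_lt_colLen] at hd2
      obtain rfl : m = d.1 := by
        simp only at hd1
        omega
      exact hrow
    obtain ⟨-, h2⟩ := hlast γ h hm
    obtain ⟨-, h4⟩ := hlast γ' h' (hcol ▸ hm)
    obtain ⟨e1, e2, e3⟩ := h2 _ rfl
    obtain ⟨f1, f2, f3⟩ := h4 (residue k (m, pRow k γ m - 1)) (by rw [hp])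
    set i := residue k (m, pRow k γ m - 1)
    have heq := ih (removeCorners k γ i) (removeCorners k γ' i) (by omega)
      (h.core_removeCorners hk i) (h'.core_removeCorners hk i) fun r => by
        have := hp r
        rw [e3, f3] at this
        omega
    rw [← act_act hk γ i, ← act_act hk γ' i, e1, f1, heq]

lemma natCast_zmod_ne_zero {k m : ℕ} (h0 : 0 < m) (hm : m ≤ k) : (m : ZMod (k + 1)) ≠ 0 := by
  intro h
  have := Nat.le_of_dvd h0 ((ZMod.natCast_eq_zero_iff m (k + 1)).1 h)
  omega

/-- Adding to a core `δ` the cells of a new row, one residue at a time. -/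
lemma IsCore.exists_add_row {k : ℕ} (hk : 1 ≤ k) {δ : YoungDiagram} (hδ : IsCore (k + 1) δ)
    {l b : ℕ} (h0 : δ.rowLen l = 0) (hb : b ≤ k)
    (hprev : ∀ r, r + 1 = l → b ≤ pRow k δ r) (a : ℕ) (ha : a ≤ b) :
    ∃ δ' : YoungDiagram, IsCore (k + 1) δ' ∧ δ ≤ δ' ∧
      (∀ r, pRow k δ' r = if r = l then a else pRow k δ r) ∧
      δ'.rowLen l = a ∧ δ'.rowLen (l + 1) = 0 ∧
      (∀ c ∈ δ', c ∉ δ → ∃ j < a, residue k c = (j : ZMod (k + 1)) - l) ∧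
      ∀ r c, (r + 1, c) ∈ δ' → (r, c) ∈ δ := by
  induction a with
  | zero =>
    have h1 : δ.rowLen (l + 1) = 0 := by
      have := δ.rowLen_anti l (l + 1) (by omega)
      omega
    refine ⟨δ, hδ, le_rfl, fun r => ?_, h0, h1, fun c hc hc' => absurd hc hc',
      fun r c h => δ.up_left_mem (Nat.le_succ r) le_rfl h⟩
    split_ifs with h
    · rw [h, pRow_eq_zero h0]
    · rfl
  | succ a ih =>
    obtain ⟨κ, hκ, hle, hrow, hlen, hlen', hres, hstrip⟩ := ih (by omega)
    have hadd : Addable κ (l, a) := by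
      rw [addable_iff]
      refine ⟨hlen.symm, ?_⟩
      rw [isBead_add_one_iff]
      rintro ⟨r, rfl, hr⟩
      have h1 := hprev r rfl
      have h2 := hrow r
      rw [if_neg (by omega)] at h2
      have h3 := pRow_le_rowLen k κ r
      omega
    obtain ⟨δ', hδ', hrem, heq⟩ := hκ.exists_removeCorners_eq hk hadd
    set i := residue k (l, a) with hi
    have hmem : ∀ c, c ∈ κ ↔ c ∈ δ' ∧ ¬ (Removable δ' c ∧ residue k c = i) := fun c => by
      rw [← heq, mem_removeCorners]
    have hnew : ∀ c, c ∈ δ' → c ∉ κ → Removable δ' c ∧ residue k c = i := by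
      intro c hc hc'
      by_contra hcon
      exact hc' ((hmem c).2 ⟨hc, hcon⟩)
    have hκδ' : κ ≤ δ' := fun c hc => ((hmem c).1 hc).1
    have hlast : (l + 1, 0) ∉ δ' := by
      intro hm
      have h1 := hnew _ hm fun h => by
        rw [YoungDiagram.mem_iff_lt_rowLen] at h
        omega
      refine natCast_zmod_ne_zero (k := k) (Nat.succ_pos a) (by omega) ?_
      have h2 := h1.2
      rw [hi] at h2
      unfold residue at h2
      push_cast at h2 ⊢
      linear_combination -h2
    have hlast0 : δ'.rowLen (l + 1) = 0 := by
      by_contra hcon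
      exact hlast (YoungDiagram.mem_iff_lt_rowLen.2 (Nat.pos_of_ne_zero hcon))
    obtain ⟨d, hd, -, hmax, hrow'⟩ := hδ'.exists_pRow_removeCorners hk hrem hi.symm
    rw [heq] at hrow'
    have hdl : d.1 = l := by
      have h1 := hmax _ hrem hi.symm
      simp only at h1
      by_contra hcon
      exact hlast (δ'.up_left_mem (by omega) (Nat.zero_le _) hd.1)
    have hres' : ∀ c ∈ δ', c ∉ δ → ∃ j < a + 1, residue k c = (j : ZMod (k + 1)) - l := by
      intro c hc hc'
      by_cases hcκ : c ∈ κ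
      · obtain ⟨j, hj, hj'⟩ := hres c hcκ hc'
        exact ⟨j, by omega, hj'⟩
      · exact ⟨a, by omega, (hnew c hc hcκ).2⟩
    refine ⟨δ', hδ', hle.trans hκδ', fun r => ?_, ?_, hlast0, hres', fun r c hc => ?_⟩
    · rw [hrow' r, hrow r, hdl]
      split_ifs <;> rfl
    · have h1 := YoungDiagram.mem_iff_lt_rowLen.1 hrem.1
      have h2 := mt YoungDiagram.mem_iff_lt_rowLen.2 hrem.2.2
      simp only at h1 h2
      omega
    · by_cases hcκ : (r + 1, c) ∈ κ
      · exact hstrip r c hcκ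
      · by_contra hcon
        have h1 := (hnew _ hc hcκ).2
        obtain ⟨j, hj, hj'⟩ := hres' (r, c) (δ'.up_left_mem (Nat.le_succ r) le_rfl hc) hcon
        refine natCast_zmod_ne_zero (k := k) (m := a + 1 - j) (by omega) (by omega) ?_
        rw [Nat.cast_sub (by omega)]
        rw [hi] at h1
        unfold residue at h1 hj'
        push_cast at h1 hj' ⊢
        linear_combination hj' - h1

theorem exists_core_isKTab {k : ℕ} (hk : 1 ≤ k) {f : ℕ → ℕ} (hf : Antitone f)
    (hfk : ∀ r, f r ≤ k) (l : ℕ) :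
    ∃ (δ : YoungDiagram) (u : ℕ × ℕ → ℕ), IsCore (k + 1) δ ∧ (∀ r < l, pRow k δ r = f r) ∧
      δ.rowLen l = 0 ∧ IsKTab k ((List.range l).map f) δ u := by
  induction l with
  | zero =>
    have hb : ∀ c, c ∉ (⊥ : YoungDiagram) := YoungDiagram.notMem_bot
    refine ⟨⊥, fun _ => 0, fun c hc => absurd hc (hb c), fun r hr => absurd hr (Nat.not_lt_zero r),
      by simp [YoungDiagram.rowLen_eq_card, YoungDiagram.row], fun c => by simp, fun c => by simp,
      fun r c h => absurd h (hb _), fun r c h => absurd h (hb _), fun i h1 h2 => ?_⟩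
    simp at h2
    omega
  | succ l ih =>
    obtain ⟨δ, u, hδ, hrow, hlen, hu⟩ := ih
    obtain ⟨δ', hδ', hle, hrow', hlen', hlast, hres, hstrip⟩ := hδ.exists_add_row hk hlen (hfk l)
      (fun r hr => by
        rw [hrow r (by omega)]
        exact hf (by omega)) (f l) le_rfl
    have hul : ∀ c, u c ≤ l := fun c => by simpa using hu.2.1 c
    set v : ℕ × ℕ → ℕ := fun c => if c ∈ δ then u c else if c ∈ δ' then l + 1 else 0 with hv
    have hv1 : ∀ c ∈ δ, v c = u c := fun c hc => by simp [hv, hc]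
    have hv2 : ∀ c ∈ δ', c ∉ δ → v c = l + 1 := fun c hc hc' => by simp [hv, hc, hc']
    have hv3 : ∀ c, c ∉ δ' → v c = 0 := fun c hc => by
      have : c ∉ δ := fun h => hc (hle h)
      simp [hv, hc, this]
    have hvle : ∀ c, v c ≤ l + 1 := fun c => by
      have := hul c
      simp only [hv]
      split_ifs <;> omega
    refine ⟨δ', v, hδ', fun r hr => ?_, hlast, fun c => ?_, fun c => ?_, fun r c h h' => ?_,
      fun r c h h' => ?_, fun i h1 h2 => ?_⟩
    · rw [hrow' r]
      split_ifs with h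
      · rw [h]
      · exact hrow r (by omega)
    · by_cases hc : c ∈ δ
      · rw [hv1 c hc]
        exact iff_of_true (hle hc) ((hu.1 c).1 hc)
      · by_cases hc' : c ∈ δ'
        · rw [hv2 c hc' hc]
          exact iff_of_true hc' (by omega)
        · rw [hv3 c hc']
          exact iff_of_false hc' (by omega)
    · simpa using hvle c
    · have hm := hstrip r c h'
      by_cases hc : (r + 1, c) ∈ δ
      · rw [hv1 _ hm, hv1 _ hc]
        exact hu.col r c hc
      · rw [hv1 _ hm, hv2 _ h' hc]
        exact Nat.lt_succ_of_le (hul _)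
    · by_cases hc : (r, c + 1) ∈ δ
      · rw [hv1 _ hc, hv1 _ (δ.up_left_mem le_rfl (Nat.le_succ c) hc)]
        exact hu.row r c hc
      · rw [hv2 _ h' hc]
        exact hvle _
    · rw [List.length_map, List.length_range] at h2
      rw [List.getD_eq_getElem _ 0 (by simp; omega), List.getElem_map, List.getElem_range]
      rcases Nat.lt_or_ge l i with hli | hli
      · obtain rfl : i = l + 1 := by omega
        rw [Nat.add_sub_cancel]
        have himage : (δ'.cells.filter fun c => v c = l + 1).image (residue k) =
            (Finset.range (f l)).image (fun j : ℕ => (j : ZMod (k + 1)) - (l : ZMod (k + 1))) := by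
          ext ρ
          simp only [Finset.mem_image, Finset.mem_filter, YoungDiagram.mem_cells, Finset.mem_range]
          constructor
          · rintro ⟨c, ⟨hc, hvc⟩, rfl⟩
            have hcδ : c ∉ δ := fun h => by
              have := hul c
              rw [hv1 c h] at hvc
              omega
            obtain ⟨j, hj, hj'⟩ := hres c hc hcδ
            exact ⟨j, hj, hj'.symm⟩
          · rintro ⟨j, hj, rfl⟩
            have hm : (l, j) ∈ δ' := YoungDiagram.mem_iff_lt_rowLen.2 (by omega)
            refine ⟨(l, j), ⟨hm, hv2 _ hm fun h => ?_⟩, rfl⟩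
            rw [YoungDiagram.mem_iff_lt_rowLen] at h
            omega
        rw [himage, Finset.card_image_of_injOn, Finset.card_range]
        intro x hx y hy hxy
        simp only [Finset.coe_range, Set.mem_Iio, sub_left_inj] at hx hy hxy
        have := hfk l
        rw [ZMod.natCast_eq_natCast_iff'] at hxy
        rwa [Nat.mod_eq_of_lt (by omega), Nat.mod_eq_of_lt (by omega)] at hxy
      · have h3 := hu.2.2.2.2 i h1 (by simpa using hli)
        rw [List.getD_eq_getElem _ 0 (by simp; omega), List.getElem_map, List.getElem_range] at h3
        rw [← h3]
        congr 2
        ext c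
        simp only [Finset.mem_filter, YoungDiagram.mem_cells]
        constructor
        · rintro ⟨hc, hvc⟩
          have hcδ : c ∈ δ := by
            by_contra hcon
            rw [hv2 c hc hcon] at hvc
            omega
          exact ⟨hcδ, (hv1 c hcδ).symm.trans hvc⟩
        · rintro ⟨hc, huc⟩
          exact ⟨hle hc, (hv1 c hc).trans huc⟩

/-! ## Triangularity of the number of `k`-tableaux -/

lemma card_eq_sum_rowLen (lam : YoungDiagram) {M : ℕ} (h : lam.rowLen M = 0) :
    lam.card = ∑ r ∈ Finset.range M, lam.rowLen r := by
  unfold YoungDiagram.card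
  rw [Finset.card_eq_sum_card_fiberwise (f := Prod.fst) (t := Finset.range M)]
  · exact Finset.sum_congr rfl fun r _ => (lam.rowLen_eq_card).symm
  · intro c hc
    rw [Finset.mem_coe, YoungDiagram.mem_cells] at hc
    rw [Finset.mem_coe, Finset.mem_range]
    by_contra hcon
    have h1 := lam.rowLen_anti M c.1 (not_lt.1 hcon)
    have h2 := YoungDiagram.mem_iff_lt_rowLen.1 (show (c.1, c.2) ∈ lam from hc)
    omega

lemma rowLen_colLen (lam : YoungDiagram) : lam.rowLen (lam.colLen 0) = 0 :=
  (rowLen_eq_zero_iff lam _).2 le_rfl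

lemma getD_rowLens (lam : YoungDiagram) (i : ℕ) : lam.rowLens.getD i 0 = lam.rowLen i := by
  by_cases h : i < lam.rowLens.length
  · rw [List.getD_eq_getElem _ _ h, YoungDiagram.get_rowLens]
  · rw [List.getD_eq_default _ _ (not_lt.1 h)]
    rw [YoungDiagram.length_rowLens] at h
    exact ((rowLen_eq_zero_iff lam i).2 (not_lt.1 h)).symm

lemma partialSum_rowLens (lam : YoungDiagram) (x : ℕ) :
    partialSum lam.rowLens x = ∑ r ∈ Finset.range x, lam.rowLen r := by
  induction x with
  | zero => simp [partialSum]
  | succ x ih => rw [partialSum_succ, ih, getD_rowLens, Finset.sum_range_succ]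

lemma sum_rowLens (lam : YoungDiagram) : lam.rowLens.sum = lam.card := by
  rw [← partialSum_length, partialSum_rowLens, YoungDiagram.length_rowLens,
    card_eq_sum_rowLen lam (rowLen_colLen lam)]

lemma IsKBounded.le_of_mem_rowLens {k : ℕ} {lam : YoungDiagram} (h : IsKBounded k lam) :
    ∀ a ∈ lam.rowLens, a ≤ k := by
  intro a ha
  obtain ⟨i, -, rfl⟩ := List.mem_map.1 ha
  exact h i

lemma eq_of_rowLen_eq {lam mu : YoungDiagram} (h : ∀ r, lam.rowLen r = mu.rowLen r) :
    lam = mu := by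
  ext ⟨r, c⟩
  rw [YoungDiagram.mem_cells, YoungDiagram.mem_cells, YoungDiagram.mem_iff_lt_rowLen,
    YoungDiagram.mem_iff_lt_rowLen, h]

namespace IsKBounded

variable {k : ℕ} {lam mu : YoungDiagram}

lemma exists_core (hk : 1 ≤ k) (h : IsKBounded k lam) :
    ∃ (δ : YoungDiagram) (u : ℕ × ℕ → ℕ), IsCore (k + 1) δ ∧ (∀ r, pRow k δ r = lam.rowLen r) ∧
      IsKTab k lam.rowLens δ u := by
  obtain ⟨δ, u, h1, h2, h3, h4⟩ :=
    exists_core_isKTab hk (fun a b hab => lam.rowLen_anti a b hab) h (lam.colLen 0)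
  refine ⟨δ, u, h1, fun r => ?_, h4⟩
  rcases Nat.lt_or_ge r (lam.colLen 0) with hr | hr
  · exact h2 r hr
  · rw [(rowLen_eq_zero_iff lam r).2 hr]
    have := δ.rowLen_anti _ _ hr
    exact pRow_eq_zero (by omega)

lemma coreOf_spec (hk : 1 ≤ k) (h : IsKBounded k lam) :
    IsCore (k + 1) (coreOf k lam) ∧ ∀ i, pRow k (coreOf k lam) i = lam.rowLen i := by
  obtain ⟨δ, -, h1, h2, -⟩ := h.exists_core hk
  exact Classical.epsilon_spec
    (p := fun γ => IsCore (k + 1) γ ∧ ∀ i, pRow k γ i = lam.rowLen i) ⟨δ, h1, h2⟩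

lemma pSize_coreOf (hk : 1 ≤ k) (h : IsKBounded k lam) : pSize k (coreOf k lam) = lam.card := by
  set M := max ((coreOf k lam).colLen 0) (lam.colLen 0)
  rw [pSize_eq_sum k ((rowLen_eq_zero_iff _ M).2 (le_max_left _ _)),
    card_eq_sum_rowLen lam ((rowLen_eq_zero_iff _ M).2 (le_max_right _ _))]
  exact Finset.sum_congr rfl fun r _ => (h.coreOf_spec hk).2 r

/-- In top degree, affine set-valued tableaux are equinumerous with `k`-tableaux. -/
theorem Kcal_eq_Kktab (hk : 1 ≤ k) (hmu : IsKBounded k mu) (h : IsKBounded k lam)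
    (hcard : mu.card = lam.card) : Kcal k mu lam.rowLens = Kktab k mu lam.rowLens :=
  card_isASVT_eq_card_isKTab hk h.le_of_mem_rowLens (hmu.coreOf_spec hk).1
    (by rw [hmu.pSize_coreOf hk, sum_rowLens, hcard])

end IsKBounded

lemma IsKTab.lt_label {k : ℕ} {α : List ℕ} {γ : YoungDiagram} {u : ℕ × ℕ → ℕ}
    (hu : IsKTab k α γ u) {r c : ℕ} (h : (r, c) ∈ γ) : r < u (r, c) := by
  induction r with
  | zero => exact hu.pos h
  | succ r ih =>
    have h1 := ih (γ.up_left_mem (Nat.le_succ r) le_rfl h)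
    have h2 := hu.col r c h
    omega

lemma IsKTab.rowLen_lowShape {k : ℕ} {α : List ℕ} {γ : YoungDiagram} {u : ℕ × ℕ → ℕ}
    (hu : IsKTab k α γ u) (x : ℕ) : (lowShape γ u x).rowLen x = 0 := by
  by_contra hcon
  have h1 := (mem_lowShape hu.mono).1 (YoungDiagram.mem_iff_lt_rowLen.2 (Nat.pos_of_ne_zero hcon))
  have h2 := hu.lt_label h1.1
  omega

namespace IsKBounded

variable {k : ℕ} {lam mu : YoungDiagram}

lemma sum_pRow_lowShape (hk : 1 ≤ k) (hmu : IsKBounded k mu) (h : IsKBounded k lam)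
    (hcard : mu.card = lam.card) {u : ℕ × ℕ → ℕ} (hu : IsKTab k lam.rowLens (coreOf k mu) u)
    (x : ℕ) : IsCore (k + 1) (lowShape (coreOf k mu) u x) ∧
      ∑ r ∈ Finset.range x, pRow k (lowShape (coreOf k mu) u x) r =
        ∑ r ∈ Finset.range x, lam.rowLen r ∧
      ∀ r, pRow k (lowShape (coreOf k mu) u x) r ≤ mu.rowLen r := by
  have h0 := hmu.coreOf_spec hk
  obtain ⟨h1, h2, h3⟩ := hu.lowShape_core hk h.le_of_mem_rowLens h0.1
    (by rw [hmu.pSize_coreOf hk, sum_rowLens, hcard]) x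
  refine ⟨h1, ?_, fun r => (h3 r).trans (h0.2 r).le⟩
  rw [← pSize_eq_sum k (hu.rowLen_lowShape x), h2, partialSum_rowLens]

theorem dominates_of_Kktab_ne_zero (hk : 1 ≤ k) (hmu : IsKBounded k mu) (h : IsKBounded k lam)
    (hcard : mu.card = lam.card) (hne : Kktab k mu lam.rowLens ≠ 0) : Dominates mu lam := by
  refine ⟨hcard, fun n => ?_⟩
  obtain ⟨⟨u, hu⟩⟩ : Nonempty {u : ℕ × ℕ → ℕ // IsKTab k lam.rowLens (coreOf k mu) u} := by
    by_contra hcon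
    rw [not_nonempty_iff] at hcon
    exact hne Nat.card_of_isEmpty
  obtain ⟨-, h2, h3⟩ := hmu.sum_pRow_lowShape hk h hcard hu n
  rw [← h2]
  exact Finset.sum_le_sum fun r _ => h3 r

theorem Kktab_self (hk : 1 ≤ k) (h : IsKBounded k lam) : Kktab k lam lam.rowLens = 1 := by
  have hlow : ∀ u, IsKTab k lam.rowLens (coreOf k lam) u → ∀ x,
      IsCore (k + 1) (lowShape (coreOf k lam) u x) ∧
      ∀ r, pRow k (lowShape (coreOf k lam) u x) r = if r < x then lam.rowLen r else 0 := by
    intro u hu x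
    obtain ⟨h1, h2, h3⟩ := h.sum_pRow_lowShape hk h rfl hu x
    refine ⟨h1, fun r => ?_⟩
    split_ifs with hr
    · exact (Finset.sum_eq_sum_iff_of_le fun r _ => h3 r).1 h2 r (Finset.mem_range.2 hr)
    · have h4 := YoungDiagram.rowLen_anti (lowShape (coreOf k lam) u x) _ _ (not_lt.1 hr)
      rw [hu.rowLen_lowShape x] at h4
      exact pRow_eq_zero (by omega)
  refine Nat.card_eq_one_iff_unique.2 ⟨⟨?_⟩, ?_⟩
  · rintro ⟨u, hu⟩ ⟨v, hv⟩
    rw [Subtype.mk.injEq]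
    funext c
    have hshape : ∀ x, lowShape (coreOf k lam) u x = lowShape (coreOf k lam) v x := fun x =>
      IsCore.eq_of_pRow_eq hk (hlow u hu x).1 (hlow v hv x).1 fun r => by
        rw [(hlow u hu x).2, (hlow v hv x).2]
    by_cases hc : c ∈ coreOf k lam
    · have hle : ∀ x, u c ≤ x ↔ v c ≤ x := fun x => by
        have h1 := mem_lowShape hu.mono (y := x) (c := c)
        have h2 := mem_lowShape hv.mono (y := x) (c := c)
        rw [hshape x] at h1
        tauto
      exact le_antisymm ((hle _).2 le_rfl) ((hle _).1 le_rfl)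
    · have h1 := mt (hu.1 c).2 hc
      have h2 := mt (hv.1 c).2 hc
      omega
  · obtain ⟨δ, u, h1, h2, h3⟩ := h.exists_core hk
    have h4 := h.coreOf_spec hk
    rw [IsCore.eq_of_pRow_eq hk h1 h4.1 fun r => (h2 r).trans (h4.2 r).symm] at h3
    exact ⟨⟨u, h3⟩⟩

end IsKBounded

/-! ## Dominance order -/

lemma Dominates.trans {a b c : YoungDiagram} (h1 : Dominates a b) (h2 : Dominates b c) :
    Dominates a c :=
  ⟨h1.1.trans h2.1, fun n => (h2.2 n).trans (h1.2 n)⟩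

lemma Dominates.antisymm {a b : YoungDiagram} (h1 : Dominates a b) (h2 : Dominates b a) :
    a = b := by
  have h : ∀ n, ∑ i ∈ Finset.range n, a.rowLen i = ∑ i ∈ Finset.range n, b.rowLen i :=
    fun n => le_antisymm (h2.2 n) (h1.2 n)
  refine eq_of_rowLen_eq fun r => ?_
  have h3 := h (r + 1)
  rw [Finset.sum_range_succ, Finset.sum_range_succ, h r] at h3
  exact Nat.add_left_cancel h3

lemma finite_card_le (n : ℕ) : {lam : YoungDiagram | lam.card ≤ n}.Finite := by
  refine Set.Finite.of_finite_image (f := YoungDiagram.cells)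
    ((Finset.range n ×ˢ Finset.range n).powerset.finite_toSet.subset ?_) fun a _ b _ h =>
      YoungDiagram.ext h
  rintro _ ⟨lam, hlam, rfl⟩
  rw [Finset.mem_coe, Finset.mem_powerset]
  intro c hc
  have hle : (Finset.range (c.1 + 1) ×ˢ {0}).card ≤ lam.card ∧
      ({0} ×ˢ Finset.range (c.2 + 1)).card ≤ lam.card := by
    constructor <;> refine Finset.card_le_card fun d hd => ?_
    all_goals
      simp only [Finset.mem_product, Finset.mem_range, Finset.mem_singleton] at hd
      refine lam.isLowerSet (Prod.le_def.2 ⟨?_, ?_⟩) hc <;> omega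
  have hlam' : lam.card ≤ n := hlam
  simp only [Finset.card_product, Finset.card_range, Finset.card_singleton] at hle
  simp only [Finset.mem_product, Finset.mem_range]
  omega

/-- Well-founded induction on dominance, from the dominant partitions downwards. -/
lemma Dominates.induction {P : YoungDiagram → Prop}
    (step : ∀ lam, (∀ mu, Dominates mu lam → mu ≠ lam → P mu) → P lam) (lam : YoungDiagram) :
    P lam := by
  have key : ∀ n, ∀ lam : YoungDiagram,
      {mu : YoungDiagram | Dominates mu lam}.ncard = n → P lam := by
    intro n
    induction n using Nat.strong_induction_on with
    | _ n ih =>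
      rintro lam rfl
      refine step lam fun mu hmu hne => ih _ ?_ mu rfl
      refine Set.ncard_lt_ncard ⟨fun nu hnu => hnu.trans hmu, fun hsub => hne ?_⟩
        ((finite_card_le lam.card).subset fun nu hnu => hnu.1.le)
      exact hmu.antisymm (hsub ⟨rfl, fun _ => le_rfl⟩)
  exact key _ lam rfl

/-! ## Comparison of the two systems -/

/-- The span of the `s μ` with `μ` a `k`-bounded partition of degree less than `n`. -/
noncomputable def lowerSpan (k : ℕ) (s : YoungDiagram → SymFunc) (n : ℕ) : Submodule ℤ SymFunc :=
  Submodule.span ℤ (s '' {μ | IsKBounded k μ ∧ μ.card < n})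

lemma sub_mem_lowerSpan {k : ℕ} (hk : 1 ≤ k) {g s : YoungDiagram → SymFunc}
    (hg : KKSchurSystem k g) (hs : KSchurSystem k s) (lam : YoungDiagram)
    (hlam : IsKBounded k lam) : g lam - s lam ∈ lowerSpan k s lam.card := by
  suffices H : ∀ n, ∀ lam : YoungDiagram, lam.card = n → IsKBounded k lam →
      g lam - s lam ∈ lowerSpan k s n from H _ lam rfl hlam
  intro n
  induction n using Nat.strong_induction_on with
  | _ n ih =>
  have hlow : ∀ μ : YoungDiagram, IsKBounded k μ → μ.card < n → g μ ∈ lowerSpan k s n := by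
    intro μ hμ hlt
    have h1 : lowerSpan k s μ.card ≤ lowerSpan k s n :=
      Submodule.span_mono (Set.image_mono fun ν hν => ⟨hν.1, hν.2.trans hlt⟩)
    have h2 : s μ ∈ lowerSpan k s n := Submodule.subset_span ⟨μ, ⟨hμ, hlt⟩, rfl⟩
    simpa using add_mem (h1 (ih _ hlt μ rfl hμ)) h2
  refine Dominates.induction fun lam hdom hn hlam => ?_
  have hgl := hg.2 lam hlam
  have hsl := hs.2 lam hlam
  set F := (finite_card_le n).toFinset with hF
  have hmem : ∀ μ : YoungDiagram, μ ∈ F ↔ μ.card ≤ n := fun μ => by simp [hF]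
  rw [finsum_eq_sum_of_support_subset (s := F) _ fun μ hμ => by
    rw [Function.mem_support] at hμ
    rw [Finset.mem_coe, hmem, ← hn]
    by_contra hcon
    exact hμ (if_neg fun h => hcon h.2)] at hgl
  rw [finsum_eq_sum_of_support_subset (s := F) _ fun μ hμ => by
    rw [Function.mem_support] at hμ
    rw [Finset.mem_coe, hmem, ← hn]
    by_contra hcon
    exact hμ (if_neg fun h => hcon h.2.1.1.le)] at hsl
  have hterm : ∀ μ ∈ F,
      (if IsKBounded k μ ∧ μ.card ≤ lam.card then
        ((-1 : ℤ) ^ (lam.card + μ.card) * (Kcal k μ lam.rowLens : ℤ)) • g μ else 0) -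
      (if IsKBounded k μ ∧ Dominates μ lam ∧ μ ≠ lam then
        (Kktab k μ lam.rowLens : ℤ) • s μ else 0) -
      (if μ = lam then g lam else 0) ∈ lowerSpan k s n := by
    intro μ hμ
    rw [hmem] at hμ
    by_cases hμk : IsKBounded k μ
    swap
    · have hne : μ ≠ lam := fun h => hμk (h ▸ hlam)
      simp [hμk, hne]
    rw [if_pos ⟨hμk, hμ.trans hn.ge⟩]
    rcases hμ.lt_or_eq with hlt | heq
    · have hne : μ ≠ lam := fun h => by
        rw [h, hn] at hlt
        exact lt_irrefl _ hlt
      rw [if_neg hne, if_neg fun h => hlt.ne (h.2.1.1.trans hn), sub_zero, sub_zero]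
      exact Submodule.smul_mem _ _ (hlow μ hμk hlt)
    · have hcard : μ.card = lam.card := heq.trans hn.symm
      rw [hcard, Even.neg_one_pow ⟨_, rfl⟩, one_mul, hμk.Kcal_eq_Kktab hk hlam hcard]
      by_cases hne : μ = lam
      · subst hne
        rw [hμk.Kktab_self hk]
        simp
      · rw [if_neg hne, sub_zero]
        by_cases hd : Dominates μ lam
        · rw [if_pos ⟨hμk, hd, hne⟩, ← smul_sub]
          exact Submodule.smul_mem _ _ (hdom μ hd hne heq hμk)
        · have hz : Kktab k μ lam.rowLens = 0 := by
            by_contra hcon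
            exact hd (hμk.dominates_of_Kktab_ne_zero hk hlam hcard hcon)
          simp [hz]
  have hsum := Submodule.sum_mem _ hterm
  rw [Finset.sum_sub_distrib, Finset.sum_sub_distrib, ← hgl,
    Finset.sum_ite_eq' F lam fun _ => g lam, if_pos ((hmem lam).2 hn.le)] at hsum
  rw [← neg_mem_iff]
  convert hsum using 1
  nth_rewrite 1 [hsl]
  ring

lemma exists_finsum_of_mem_lowerSpan {k : ℕ} {s : YoungDiagram → SymFunc} {n : ℕ} {p : SymFunc}
    (hp : p ∈ lowerSpan k s n) :
    ∃ d : YoungDiagram → ℤ, (∀ μ, d μ ≠ 0 → IsKBounded k μ ∧ μ.card < n) ∧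
      p = ∑ᶠ μ, d μ • s μ := by
  obtain ⟨d, hd, rfl⟩ := (Finsupp.mem_span_image_iff_linearCombination ℤ).1 hp
  refine ⟨d, fun μ hμ => (Finsupp.mem_supported ℤ d).1 hd (Finsupp.mem_support_iff.2 hμ), ?_⟩
  rw [Finsupp.linearCombination_apply, Finsupp.sum]
  refine (finsum_eq_sum_of_support_subset _ fun μ hμ => ?_).symm
  rw [Function.mem_support] at hμ
  rw [Finset.mem_coe, Finsupp.mem_support_iff]
  intro h
  exact hμ (by rw [h, zero_smul])

/-- For any `k`-bounded partition `λ`, the difference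
`g^{(k)}_λ - s^{(k)}_λ` lies in the `ℤ`-span of the `k`-Schur functions `s^{(k)}_μ` with
`μ ∈ 𝒫^k`, `|μ| < |λ|`: `g^{(k)}_λ = s^{(k)}_λ + Σ_{|μ| < |λ|} d^{(k)}_{λμ} s^{(k)}_μ` with
integer coefficients, so the top homogeneous component of `g^{(k)}_λ` is `s^{(k)}_λ`. -/
theorem kKSchur_top_is_kSchur
    (k : ℕ) (hk : 1 ≤ k)
    (g : YoungDiagram → SymFunc) (hg : KKSchurSystem k g)
    (s : YoungDiagram → SymFunc) (hs : KSchurSystem k s)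
    (lam : YoungDiagram) (hlam : IsKBounded k lam) :
    ∃ d : YoungDiagram → ℤ,
      (∀ μ : YoungDiagram, d μ ≠ 0 → IsKBounded k μ ∧ μ.card < lam.card) ∧
      g lam = s lam + ∑ᶠ μ : YoungDiagram, d μ • s μ := by
  obtain ⟨d, hd, h⟩ := exists_finsum_of_mem_lowerSpan (sub_mem_lowerSpan hk hg hs lam hlam)
  exact ⟨d, hd, by rw [← h, add_sub_cancel]⟩

end AffineKTheory
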